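/- arXiv:1903.12526 — 2 statements merged into one kernel-verified Lean document; each statement's English description precedes it below -/
import Mathlib

section
/- Define F₁ := −(1/24)·log ϱ₀ and, for g ≥ 2, F_g := (1/((2g−2)(2λ)⁴))·Â_ǎ(z ↦ G_g(z)). Then: (i) (2λ)⁴·Â†_z F_g = G_g(z) for every g ≥ 1 and every z ≠ 0; (ii) for g ≥ 2, F_g is the unique function of the variables ϱ_l satisfying both (2λ)⁴·Â†_z F = G_g(z) and N̂F = (2g−2)·F; (iii) for g ≥ 2, F_g = (2λ)^{4g−4}·P_{3g−3}(ϱ)/ϱ₀^{2g−2}, where P_{3g−3} is a (3g−3)-weighted polynomial with rational coefficients in ϱ₁/ϱ₀, …, ϱ_{3g−3}/ϱ₀. -/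
open scoped BigOperators
open MeasureTheory

noncomputable section

namespace NCQFT

/-! ### Measure data: the planar 1‑point function `G0fun`, the moments and the operator `K̂`. -/

/-- The planar one-point function `𝒢₀(z) = s·z − n̄ + ½∫ᵃᵇ r(y)/((z+y)y) dy`. -/
def G0fun (a b s nbar : ℝ) (r : ℝ → ℝ) (z : ℂ) : ℂ :=
  (s : ℂ) * z - (nbar : ℂ) + (1 / 2) * ∫ y in a..b, (r y : ℂ) / ((z + (y : ℂ)) * (y : ℂ))

/-- Moments `ϱ_l = s·δ_{l,0} − ½∫ᵃᵇ r(y)/y^{3+2l} dy` of the measure. -/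
def moment (a b s : ℝ) (r : ℝ → ℝ) (l : ℕ) : ℝ :=
  (if l = 0 then s else 0) - (1 / 2) * ∫ y in a..b, r y / y ^ (3 + 2 * l)

/-- The integral operator `K̂`. -/
def Khat (a b s nbar : ℝ) (r : ℝ → ℝ) (f : ℂ → ℂ) (z : ℂ) : ℂ :=
  G0fun a b s nbar r z * f z + (nbar : ℂ) * f z
    + (1 / 2) * ∫ y in a..b, (r y : ℂ) * (f z - f (y : ℂ)) / (z ^ 2 - (y : ℂ) ^ 2)

/-- Admissible points: `z ∉ [a,b] ∪ (−[a,b]) ∪ {0}`. -/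
def Admissible (a b : ℝ) (z : ℂ) : Prop :=
  z ≠ 0 ∧ ∀ y : ℝ, y ∈ Set.Icc a b → z ≠ (y : ℂ) ∧ z ≠ -(y : ℂ)

/-! ### Partial Bell polynomials and the polynomials `S_m(ϱ)`. -/

/-- Partial Bell polynomial `B_{n,k}(x₁,…,x_{n−k+1})`. -/
def bellP (n k : ℕ) (x : ℕ → ℝ) : ℝ :=
  ∑ j : Fin n → Fin (n + 1),
    if (∑ i : Fin n, (j i : ℕ)) = k ∧ (∑ i : Fin n, ((i : ℕ) + 1) * (j i : ℕ)) = n then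
      (n.factorial : ℝ) / (∏ i : Fin n, ((j i : ℕ).factorial : ℝ)) *
        ∏ i : Fin n, (x ((i : ℕ) + 1) / (((i : ℕ) + 1).factorial : ℝ)) ^ (j i : ℕ)
    else 0

/-- `S_m(ϱ) = Σ_{i=0}^m (−1)^i i! ϱ₀^{−i} B_{m,i}(1!ϱ₁,…,(m−i+1)!ϱ_{m−i+1})`. -/
def Sm (ρ : ℕ → ℝ) (m : ℕ) : ℝ :=
  ∑ i ∈ Finset.range (m + 1),
    (-1) ^ i * (i.factorial : ℝ) * ((ρ 0)⁻¹) ^ i *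
      bellP m i (fun j => (j.factorial : ℝ) * ρ j)

/-! ### Partial derivatives in the moment variables. -/

/-- Partial derivative `∂/∂ϱ_l` of a real-valued function of the moments. -/
def pdR (c : (ℕ → ℝ) → ℝ) (l : ℕ) (ρ : ℕ → ℝ) : ℝ :=
  deriv (fun t => c (Function.update ρ l t)) (ρ l)

/-- Partial derivative `∂/∂ϱ_l` of a complex-valued function of the moments. -/
def pdC (c : (ℕ → ℝ) → ℂ) (l : ℕ) (ρ : ℕ → ℝ) : ℂ :=
  deriv (fun t : ℝ => c (Function.update ρ l t)) (ρ l)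

/-! ### Boundary creation operators. -/

/-- Boundary creation operator `Â†_{z_J,w}` with free creation variable `w`, acting on a
family `F` of the moments `ϱ` and boundary variables `(z_i)_{i∈J}`. -/
def AdagFree (J : Finset ℕ) (F : (ℕ → ℝ) → (ℕ → ℂ) → ℂ)
    (ρ : ℕ → ℝ) (z : ℕ → ℂ) (w : ℂ) : ℂ :=
  (∑' l : ℕ, (-((3 + 2 * (l : ℂ)) * (ρ (l + 1) : ℂ)) / ((ρ 0 : ℂ) * w ^ 3)
      + (3 + 2 * (l : ℂ)) / w ^ (5 + 2 * l)) * pdC (fun σ => F σ z) l ρ)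
  + ∑ i ∈ J, (1 / ((ρ 0 : ℂ) * w ^ 3 * z i)) *
      deriv (fun v => F ρ (Function.update z i v)) (z i)

/-- Boundary creation operator creating a boundary at coordinate `p`. -/
def AdagVar (J : Finset ℕ) (p : ℕ) (F : (ℕ → ℝ) → (ℕ → ℂ) → ℂ) :
    (ℕ → ℝ) → (ℕ → ℂ) → ℂ :=
  fun ρ z => AdagFree J F ρ z (z p)

/-- Boundary creation operator `Â†_w` acting on scalar functions of the moments only. -/
def AdagScalar (F : (ℕ → ℝ) → ℝ) (ρ : ℕ → ℝ) (w : ℂ) : ℂ :=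
  ∑' l : ℕ, (-((3 + 2 * (l : ℂ)) * (ρ (l + 1) : ℂ)) / ((ρ 0 : ℂ) * w ^ 3)
      + (3 + 2 * (l : ℂ)) / w ^ (5 + 2 * l)) * (pdR F l ρ : ℂ)

/-! ### The genus recursion for the 1-boundary functions `𝒢_g(z) = Σ_k c_{g,k}(ϱ)/z^{2k+3}`. -/

/-- Coefficients `e_m(ϱ)` of the even bracket
`w²·(Σ_{h=1}^{g-1} G_h(w)G_{g−h}(w) + (2λ)²·G_{g−1}(w|w))`, expressed through the table
`prev` of the coefficients of the lower-genus one-boundary functions. -/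
def eBr (lam : ℝ) (g : ℕ) (prev : ℕ → ℕ → (ℕ → ℝ) → ℝ) (m : ℕ) (ρ : ℕ → ℝ) : ℝ :=
  (∑ h ∈ Finset.Icc 1 (g - 1), ∑ i ∈ Finset.range (m + 1), ∑ j ∈ Finset.range (m + 1),
      if i + j + 2 = m then prev h i ρ * prev (g - h) j ρ else 0)
  + (2 * lam) ^ 4 *
    ((if 2 ≤ m then
        -(1 / ρ 0) * ∑' l : ℕ, (3 + 2 * (l : ℝ)) * ρ (l + 1) * pdR (prev (g - 1) (m - 2)) l ρ
      else 0)
    + (∑ k ∈ Finset.range (m + 1), ∑ l ∈ Finset.range (m + 1),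
        if k + l + 3 = m then (3 + 2 * (l : ℝ)) * pdR (prev (g - 1) k) l ρ else 0)
    + (if 3 ≤ m then -(((2 * (m - 3) + 3 : ℕ) : ℝ) * prev (g - 1) (m - 3) ρ) / ρ 0 else 0))

/-- Table of the coefficients of the one-boundary functions for all genera `h ≤ G`.
`Gtab lam G h k ρ` is the coefficient of `z^{-(2k+3)}` in `𝒢_h(z)`. -/
def Gtab (lam : ℝ) : ℕ → ℕ → ℕ → (ℕ → ℝ) → ℝ
  | 0 => fun _ _ _ => 0
  | 1 => fun h k ρ =>
      if h = 1 then
        (if k = 0 then 2 * lam ^ 4 * ρ 1 / (ρ 0) ^ 2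
         else if k = 1 then -(2 * lam ^ 4) / ρ 0 else 0)
      else 0
  | (G + 2) => fun h k ρ =>
      if h ≤ G + 1 then Gtab lam (G + 1) h k ρ
      else if h = G + 2 then
        -(1 / (2 * ρ 0)) *
          ∑' j : ℕ, eBr lam (G + 2) (Gtab lam (G + 1)) (k + j) ρ * Sm ρ j / (j.factorial : ℝ)
      else 0

/-- Coefficients of the genus-`g` one-boundary function. -/
def Gcoef (lam : ℝ) (g : ℕ) : ℕ → (ℕ → ℝ) → ℝ := Gtab lam g g

/-- One-boundary function `𝒢_g(z)` of genus `g ≥ 1`. -/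
def Gfun (lam : ℝ) (g : ℕ) (ρ : ℕ → ℝ) (z : ℂ) : ℂ :=
  ∑' k : ℕ, (Gcoef lam g k ρ : ℂ) / z ^ (2 * k + 3)

/-- The same-point two-boundary function `𝒢_g(z|z)`, with
`𝒢₀(z|z) := λ²/z⁴` and `𝒢_g(z|z) := (2λ)²(Â†_z + (1/(ϱ₀z⁴))∂_z)𝒢_g(z)` for `g ≥ 1`. -/
def Gpair (lam : ℝ) (g : ℕ) (ρ : ℕ → ℝ) (z : ℂ) : ℂ :=
  if g = 0 then (lam : ℂ) ^ 2 / z ^ 4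
  else (2 * (lam : ℂ)) ^ 2 *
    ((∑' l : ℕ, (-((3 + 2 * (l : ℂ)) * (ρ (l + 1) : ℂ)) / ((ρ 0 : ℂ) * z ^ 3)
        + (3 + 2 * (l : ℂ)) / z ^ (5 + 2 * l)) * pdC (fun σ => Gfun lam g σ z) l ρ)
     + (1 / ((ρ 0 : ℂ) * z ^ 4)) * deriv (Gfun lam g ρ) z)

/-! ### Multi-boundary functions. -/

/-- Iterated boundary creation for `g ≥ 1` (without prefactors); coordinates `0,…,B−1`. -/
def GBraw (lam : ℝ) (g : ℕ) : ℕ → (ℕ → ℝ) → (ℕ → ℂ) → ℂ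
  | 0 => fun _ _ => 0
  | 1 => fun ρ z => Gfun lam g ρ (z 0)
  | (B + 2) => AdagVar (Finset.range (B + 1)) (B + 1) (GBraw lam g (B + 1))

/-- Iterated boundary creation for `g = 0` (without prefactors), starting from `𝒢₀(z₁|z₂)`. -/
def GBraw0 (lam : ℝ) : ℕ → (ℕ → ℝ) → (ℕ → ℂ) → ℂ
  | 0 => fun _ _ => 0
  | 1 => fun _ _ => 0
  | 2 => fun _ z => 4 * (lam : ℂ) ^ 2 / (z 0 * z 1 * (z 0 + z 1) ^ 2)
  | (B + 3) => AdagVar (Finset.range (B + 2)) (B + 2) (GBraw0 lam (B + 2))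

/-- The multi-boundary functions `𝒢_g(z₁|…|z_B)`, with variables at coordinates `0,…,B−1`:
`𝒢_g(z₁|…|z_B) = (2λ)^{3B−4} Â†_{(z₁..z_{B−1}),z_B}(⋯ Â†_{(z₁),z₂}𝒢_g(z₁)⋯)` for `g ≥ 1`,
and `𝒢₀(z₁|…|z_B) = (2λ)^{3B−6} Â†(⋯ Â†𝒢₀(z₁|z₂)⋯)` for `g = 0`. -/
def GBfun (lam : ℝ) (g B : ℕ) (ρ : ℕ → ℝ) (z : ℕ → ℂ) : ℂ :=
  if g = 0 then (2 * (lam : ℂ)) ^ (3 * B - 6) * GBraw0 lam B ρ z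
  else if B = 1 then Gfun lam g ρ (z 0)
  else (2 * (lam : ℂ)) ^ (3 * B - 4) * GBraw lam g B ρ z

/-! ### Free energies and boundary annihilation. -/

/-- Boundary annihilation applied to `𝒢_g`:  `Â_ǎ 𝒢_g = −Σ_l ϱ_l/(3+2l) · c_{g,l+1}(ϱ)`
(the coefficient of `z^{−5−2l}` in `𝒢_g(z)` is `c_{g,l+1}`). -/
def AcheckG (lam : ℝ) (g : ℕ) (ρ : ℕ → ℝ) : ℝ :=
  -∑' l : ℕ, ρ l / (3 + 2 * (l : ℝ)) * Gcoef lam g (l + 1) ρ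

/-- Free energies: `F₁ = −(1/24)·log ϱ₀`, and
`F_g = (1/((2g−2)(2λ)⁴))·Â_ǎ(𝒢_g)` for `g ≥ 2`. -/
def Ffree (lam : ℝ) (g : ℕ) (ρ : ℕ → ℝ) : ℝ :=
  if g = 1 then -(1 / 24) * Real.log (ρ 0)
  else 1 / ((2 * (g : ℝ) - 2) * (2 * lam) ^ 4) * AcheckG lam g ρ

/-! ### Auxiliary notions. -/

/-- Variable assignment `(z₁, z_{i₁}, z_{i₂}, …)` with first slot `w` and the remaining slots
filled by the coordinates of `z` indexed by the set `I` in increasing order. -/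
def slotAt (z : ℕ → ℂ) (w : ℂ) (I : Finset ℕ) : ℕ → ℂ :=
  fun n => if n = 0 then w else z ((I.sort (· ≤ ·)).getD (n - 1) 0)

/-- A polynomial in variables `x₁,…,x_j` is `j`-weighted if each of its monomials
`∏ x_i^{m_i}` satisfies `Σ i·m_i = j`. -/
def IsWeighted (j : ℕ) (P : MvPolynomial (Fin j) ℚ) : Prop :=
  ∀ m ∈ P.support, (∑ i : Fin j, ((i : ℕ) + 1) * m i) = j

/-- A smooth family `F(ϱ₀,…,ϱ_M; (z_i)_{i∈J})`: it factors through a function of the first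
`M+1` moments and the coordinates in `J` which is smooth (and holomorphic in each `z_i`)
on the region `ϱ₀ ≠ 0`, `z_i ≠ 0`. -/
def SmoothFam (M : ℕ) (J : Finset ℕ) (F : (ℕ → ℝ) → (ℕ → ℂ) → ℂ) : Prop :=
  ∃ Ft : ((Fin (M + 1) → ℝ) × ({ i // i ∈ J } → ℂ)) → ℂ,
    ContDiffOn ℝ (⊤ : ℕ∞) Ft { x | x.1 0 ≠ 0 ∧ ∀ i, x.2 i ≠ 0 } ∧
    (∀ x ∈ ({ x : (Fin (M + 1) → ℝ) × ({ i // i ∈ J } → ℂ) |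
        x.1 0 ≠ 0 ∧ ∀ i, x.2 i ≠ 0 }), ∀ i,
      DifferentiableAt ℂ (fun w => Ft (x.1, Function.update x.2 i w)) (x.2 i)) ∧
    ∀ ρ z, F ρ z = Ft (fun l => ρ (l : ℕ), fun i => z (i : ℕ))

/-- A smooth scalar function of `ϱ₀ ≠ 0, ϱ₁, …, ϱ_M`. -/
def SmoothScalarFam (M : ℕ) (F : (ℕ → ℝ) → ℝ) : Prop :=
  ∃ Ft : (Fin (M + 1) → ℝ) → ℝ,
    ContDiffOn ℝ (⊤ : ℕ∞) Ft { v | v 0 ≠ 0 } ∧ ∀ ρ : ℕ → ℝ, F ρ = Ft (fun l => ρ (l : ℕ))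

/-! ### The Laplacian of Theorem `Δ_ϱ`. -/

/-- `R_m(ϱ) = −(2/3) Σ_{k=1}^m (kϱ_k/((3+2k)ϱ₀))·S_{m−k}(ϱ)/(m−k)!`. -/
def Rm (ρ : ℕ → ℝ) (m : ℕ) : ℝ :=
  -(2 / 3) * ∑ k ∈ Finset.Icc 1 m,
    ((k : ℝ) * ρ k / ((3 + 2 * (k : ℝ)) * ρ 0)) * (Sm ρ (m - k) / ((m - k).factorial : ℝ))

/-- The Laplacian `Δ_ϱ`, acting on functions of the moments. -/
def DeltaRho (F : (ℕ → ℝ) → ℝ) (ρ : ℕ → ℝ) : ℝ :=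
  -(-(6 * ρ 1 ^ 3) / (5 * ρ 0 ^ 3) + 111 * ρ 1 * ρ 2 / (70 * ρ 0 ^ 2)
      - ρ 3 / (2 * ρ 0)) * pdR (fun σ => pdR F 0 σ) 0 ρ
  - (2 * ρ 1 ^ 3 / ρ 0 ^ 4 - 1097 * ρ 1 * ρ 2 / (280 * ρ 0 ^ 3)
      + 41 * ρ 3 / (24 * ρ 0 ^ 2)) * pdR F 0 ρ
  - (∑' k : ℕ, (3 + 2 * ((k : ℝ) + 1)) *
      ((-(2 * ρ 1 ^ 2 / (5 * ρ 0 ^ 3)) + 2 * ρ 2 / (7 * ρ 0 ^ 2)) * ρ (k + 2)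
        - 3 * Rm ρ (k + 3) * ρ 1 / (2 * ρ 0) + 3 * Rm ρ (k + 4) / 2) *
      pdR (fun σ => pdR F 0 σ) (k + 1) ρ)
  - (∑' k : ℕ, ∑' l : ℕ, (3 + 2 * ((k : ℝ) + 1)) * (3 + 2 * ((l : ℝ) + 1)) *
      (-(ρ 1 * ρ (l + 2) * ρ (k + 2) / (30 * ρ 0 ^ 2))
        - ρ (k + 2) * Rm ρ (l + 3) / (4 * ρ 0)
        - ρ (l + 2) * Rm ρ (k + 3) / (4 * ρ 0)
        + Rm ρ (k + l + 5) / 4) *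
      pdR (fun σ => pdR F (l + 1) σ) (k + 1) ρ)
  - (∑' k : ℕ, (3 + 2 * ((k : ℝ) + 1)) *
      ((19 * ρ 1 ^ 2 / (60 * ρ 0 ^ 4) - 25 * ρ 2 / (84 * ρ 0 ^ 3)) * ρ (k + 2)
        + ρ 1 * Rm ρ (k + 3) / (16 * ρ 0 ^ 2)
        - Rm ρ (k + 4) / (16 * ρ 0)
        - (5 + 2 * ((k : ℝ) + 1)) * ρ 1 * ρ (k + 3) / (30 * ρ 0 ^ 3)
        - (5 + 2 * ((k : ℝ) + 1)) * Rm ρ (k + 4) / (2 * ρ 0)) *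
      pdR F (k + 1) ρ)

/-- The operator `D = −(2λ)⁴Δ_ϱ + (2λ)⁴·(−21ϱ₁³/(160ϱ₀⁵)+29ϱ₁ϱ₂/(128ϱ₀⁴)−35ϱ₃/(384ϱ₀³))·`. -/
def Dop (lam : ℝ) (F : (ℕ → ℝ) → ℝ) : (ℕ → ℝ) → ℝ :=
  fun ρ => -(2 * lam) ^ 4 * DeltaRho F ρ
    + (2 * lam) ^ 4 * (-(21 / 160) * ρ 1 ^ 3 / ρ 0 ^ 5 + (29 / 128) * ρ 1 * ρ 2 / ρ 0 ^ 4
        - (35 / 384) * ρ 3 / ρ 0 ^ 3) * F ρ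

end NCQFT

section PAsec


set_option linter.unusedSimpArgs false
set_option linter.unusedSectionVars false

noncomputable section PAnc

namespace Aux9

open PowerSeries

variable {R : Type*} [CommRing R] [Algebra ℚ R]

/-- coefficientwise extension of a derivation to power series -/
def cw (D : Derivation ℚ R R) : Derivation ℚ R⟦X⟧ R⟦X⟧ :=
  Derivation.mk'
    { toFun := fun f => PowerSeries.mk (fun n => D (coeff n f))
      map_add' := by intro f g; ext n; simp
      map_smul' := by intro c f; ext n; simp }
    (by
      intro f g
      ext n
      simp only [LinearMap.coe_mk, AddHom.coe_mk, coeff_mk, coeff_mul, map_sum, Derivation.leibniz,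
        smul_eq_mul, map_add, Finset.sum_add_distrib]
      congr 1
      rw [← Finset.Nat.sum_antidiagonal_swap]
      simp only [Prod.fst_swap, Prod.snd_swap])

@[simp] lemma coeff_cw (D : Derivation ℚ R R) (f : R⟦X⟧) (n : ℕ) :
    coeff n (cw D f) = D (coeff n f) := by
  simp [cw]

@[simp] lemma cw_C (D : Derivation ℚ R R) (r : R) : cw D (C r) = C (D r) := by
  ext n
  simp only [coeff_cw, coeff_C]
  split_ifs <;> simp

@[simp] lemma cw_X (D : Derivation ℚ R R) : cw D (X : R⟦X⟧) = 0 := by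
  ext n
  simp only [coeff_cw, coeff_X]
  split_ifs <;> simp

@[simp] lemma cw_natCast (D : Derivation ℚ R R) (n : ℕ) : cw D (n : R⟦X⟧) = 0 := by
  simp

/-- the formal derivative in the power series variable -/
def dX : Derivation ℚ R⟦X⟧ R⟦X⟧ := (PowerSeries.derivative R).restrictScalars ℚ

@[simp] lemma coeff_dX (f : R⟦X⟧) (n : ℕ) : coeff n (dX f) = coeff (n+1) f * (n+1) :=
  coeff_derivative f n

@[simp] lemma dX_X : dX (X : R⟦X⟧) = 1 := derivative_X
@[simp] lemma dX_C (r : R) : dX (C r : R⟦X⟧) = 0 := derivative_C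

lemma dX_cw (D : Derivation ℚ R R) (f : R⟦X⟧) : dX (cw D f) = cw D (dX f) := by
  ext n
  simp [mul_comm]

/-- derivations with Virasoro-type commutation relations -/
structure VD (R : Type*) [CommRing R] [Algebra ℚ R] where
  a : ℕ → Derivation ℚ R R
  u : ℕ → Derivation ℚ R R
  x : R
  aa : ∀ i j f, a (i+1) (a (j+1) f) = a (j+1) (a (i+1) f)
  a0 : ∀ (i : ℕ) f, a (i+1) (a 0 f) = a 0 (a (i+1) f) - (2*i+3) * x * a i f
  ua : ∀ (n i : ℕ) f, u n (a (i+1) f) = a (i+1) (u n f) - (2*i+3) * a (n+i+1) f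
  u0 : ∀ f, u 0 (a 0 f) = a 0 (u 0 f) - a 0 f
  us : ∀ (n : ℕ) f, u (n+1) (a 0 f) = a 0 (u (n+1) f) - a (n+1) f - 2*(n+2)*x*u n f
  a1x : a 1 x = - (3 * x^2)
  a2x : ∀ j, a (j+2) x = 0

lemma coeff_natCast_mul (n k : ℕ) (f : R⟦X⟧) : coeff n ((k : R⟦X⟧) * f) = k * coeff n f := by
  have : ((k : R⟦X⟧)) = C (k : R) := (map_natCast C k).symm
  rw [this, coeff_C_mul]

lemma coeff_ofNat_mul (n k : ℕ) [k.AtLeastTwo] (f : R⟦X⟧) :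
    coeff n ((OfNat.ofNat k : R⟦X⟧) * f) = OfNat.ofNat k * coeff n f := by
  have : ((OfNat.ofNat k : R⟦X⟧)) = C (OfNat.ofNat k : R) := (map_ofNat C k).symm
  rw [this, coeff_C_mul]

lemma C_two : (C 2 : R⟦X⟧) = 2 := map_ofNat C 2
lemma C_three : (C 3 : R⟦X⟧) = 3 := map_ofNat C 3

/-- lift to power series -/
def VD.lift (V : VD R) : VD R⟦X⟧ where
  a i := cw (V.a i)
  u i := cw (V.u i)
  x := C V.x
  aa i j f := by ext n; simp [V.aa i j]
  a0 i f := by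
    ext n
    have : (2 * (i : R⟦X⟧) + 3) * C V.x = C ((2*i+3) * V.x) := by
      simp [C_two, C_three]
    rw [this]
    simp only [coeff_cw, V.a0, map_sub, coeff_C_mul]
  ua m i f := by
    ext n
    have : (2 * (i : R⟦X⟧) + 3) = C (2*(i:R)+3) := by
      simp [C_two, C_three]
    rw [this]
    simp only [coeff_cw, V.ua, map_sub, coeff_C_mul]
  u0 f := by ext n; simp [V.u0]
  us m f := by
    ext n
    have : 2 * ((m : R⟦X⟧) + 2) * C V.x = C (2*(m+2) * V.x) := by
      simp [C_two, C_three]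
    rw [this]
    simp only [coeff_cw, V.us, map_sub, coeff_C_mul]
  a1x := by simp [V.a1x, C_three]
  a2x j := by simp [V.a2x]

/-! ### extended ring -/

def VD.b (V : VD R) : ℕ → Derivation ℚ R⟦X⟧ R⟦X⟧
  | 0 => dX
  | (i+1) => cw (V.a (i+1))

def VD.U (V : VD R) (n : ℕ) : Derivation ℚ R⟦X⟧ R⟦X⟧ := cw (V.u n) + (X : R⟦X⟧) • V.b n

def VD.s (V : VD R) : Derivation ℚ R⟦X⟧ R⟦X⟧ := dX - cw (V.a 0)

def VD.ext (V : VD R) (F : R) : R⟦X⟧ :=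
  PowerSeries.mk fun j => ((1 : ℚ) / (j.factorial : ℚ)) • (V.a 0)^[j] F

variable (V : VD R)

lemma VD.b_comm (i j : ℕ) (f : R⟦X⟧) : V.b i (V.b j f) = V.b j (V.b i f) := by
  cases i <;> cases j
  · rfl
  · exact dX_cw _ _
  · exact (dX_cw _ _).symm
  · exact V.lift.aa _ _ _

lemma VD.b_X (i : ℕ) : V.b (i+1) X = 0 := cw_X _

lemma VD.U_b (n i : ℕ) (f : R⟦X⟧) :
    V.U n (V.b i f) = V.b i (V.U n f) - (2*i+1) * V.b (n+i) f := by
  cases i with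
  | zero =>
    have h := V.b_comm n 0 f
    simp only [VD.U, Derivation.add_apply, Derivation.smul_apply, smul_eq_mul, map_add,
      Derivation.leibniz]
    rw [h]
    have e1 : V.b 0 (cw (V.u n) f) = cw (V.u n) (V.b 0 f) := dX_cw _ _
    have e2 : V.b 0 X = 1 := dX_X
    rw [e1, e2]
    simp
    ring
  | succ i =>
    have h := V.b_comm n (i+1) f
    have h2 := V.lift.ua n i f
    simp only [VD.U, Derivation.add_apply, Derivation.smul_apply, smul_eq_mul, map_add,
      Derivation.leibniz]
    rw [h]
    simp only [V.b_X]
    have e1 : V.b (n + (i+1)) f = V.lift.a (n+i+1) f := rfl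
    have e2 : V.b (i+1) = V.lift.a (i+1) := rfl
    have e3 : cw (V.u n) = V.lift.u n := rfl
    rw [e1, e2, e3, h2]
    push_cast
    ring

lemma VD.s_b0 (f : R⟦X⟧) : V.s (V.b 0 f) = V.b 0 (V.s f) := by
  simp [VD.s, VD.b, dX_cw]

lemma VD.s_bs (i : ℕ) (f : R⟦X⟧) :
    V.s (V.b (i+1) f) = V.b (i+1) (V.s f) - (2*i+3) * C V.x * cw (V.a i) f := by
  have h := V.lift.a0 i f
  simp only [VD.s, VD.b, Derivation.sub_apply, map_sub, dX_cw]
  simp only [VD.lift] at h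
  rw [h]; ring

lemma VD.cwa0 (f : R⟦X⟧) : cw (V.a 0) f = V.b 0 f - V.s f := by
  simp [VD.s, VD.b]

lemma VD.s_b1 (f : R⟦X⟧) :
    V.s (V.b 1 f) = V.b 1 (V.s f) - 3 * C V.x * (V.b 0 f - V.s f) := by
  have := V.s_bs 0 f
  rw [V.cwa0] at this
  simpa using this

lemma VD.s_b2 (i : ℕ) (f : R⟦X⟧) :
    V.s (V.b (i+2) f) = V.b (i+2) (V.s f) - (2*i+5) * C V.x * V.b (i+1) f := by
  have := V.s_bs (i+1) f
  rw [this]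
  push_cast
  simp only [VD.b]
  ring

lemma VD.s_ext (F : R) : V.s (V.ext F) = 0 := by
  ext n
  simp only [VD.s, Derivation.sub_apply, map_sub, coeff_dX, coeff_cw, VD.ext, coeff_mk,
    map_zero, Derivation.map_smul, ← Function.iterate_succ_apply']
  rw [sub_eq_zero]
  have h : ((n : R) + 1) = algebraMap ℚ R ((n : ℚ) + 1) := by simp
  rw [h, mul_comm, ← Algebra.smul_def, smul_smul]
  congr 1
  rw [Nat.factorial_succ]
  push_cast
  have : ((n:ℚ)+1) ≠ 0 := by positivity
  have : ((n.factorial:ℚ)) ≠ 0 := by positivity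
  field_simp

local notation "ε" => (constantCoeff (R := R))

lemma ε_cw (D : Derivation ℚ R R) (f : R⟦X⟧) : ε (cw D f) = D (ε f) := by
  rw [← coeff_zero_eq_constantCoeff_apply, coeff_cw, coeff_zero_eq_constantCoeff_apply]

lemma VD.ε_ext (F : R) : ε (V.ext F) = F := by
  rw [← coeff_zero_eq_constantCoeff_apply]
  simp [VD.ext]

lemma VD.ε_bs (i : ℕ) (f : R⟦X⟧) : ε (V.b (i+1) f) = V.a (i+1) (ε f) := ε_cw _ _

lemma VD.ε_b0 (f : R⟦X⟧) : ε (V.b 0 f) = V.a 0 (ε f) + ε (V.s f) := by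
  rw [← ε_cw, V.cwa0]; simp

lemma VD.ε_U (n : ℕ) (f : R⟦X⟧) : ε (V.U n f) = V.u n (ε f) := by
  simp [VD.U, ε_cw]

lemma VD.s_X : V.s X = 1 := by simp [VD.s]

lemma VD.b_Cx (i : ℕ) : V.b (i+1) (C V.x) = C (V.a (i+1) V.x) := cw_C _ _

lemma VD.b0_C (r : R) : V.b 0 (C r) = 0 := dX_C _

/-- the lifted one-point coefficients -/
lemma VD.s_p0 (F : R) : V.s (V.b 0 (V.ext F)) = 0 := by
  rw [V.s_b0, V.s_ext, map_zero]

lemma VD.s_ps (F : R) (i : ℕ) :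
    V.s (V.b (i+1) (V.ext F)) = - ((2*i+3) * C V.x * V.b i (V.ext F)) := by
  cases i with
  | zero => rw [V.s_b1, V.s_ext]; simp
  | succ i => rw [V.s_b2, V.s_ext]; push_cast; simp; ring

lemma VD.s_U0 (F : R) : V.s (V.U 0 (V.ext F)) = 0 := by
  have h0 := V.s_ext F
  have h1 : V.b 0 (V.ext F) = cw (V.a 0) (V.ext F) := by rw [V.cwa0, h0, sub_zero]
  have h2 := V.lift.u0 (V.ext F)
  simp only [VD.lift] at h2
  have h3 : V.s (cw (V.u 0) (V.ext F)) =
      cw (V.u 0) (V.b 0 (V.ext F)) - cw (V.a 0) (cw (V.u 0) (V.ext F)) := by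
    simp [VD.s, VD.b, dX_cw]
  simp only [VD.U, Derivation.add_apply, Derivation.smul_apply, smul_eq_mul, map_add,
      Derivation.leibniz, V.s_X, V.s_p0, h3]
  rw [h1, h2]
  ring

lemma VD.s_Us (F : R) (n : ℕ) : V.s (V.U (n+1) (V.ext F)) =
    - (2 * ((n : R⟦X⟧)+2) * C V.x * V.U n (V.ext F)) + C V.x * X * V.b n (V.ext F) := by
  have h0 := V.s_ext F
  have h1 : V.b 0 (V.ext F) = cw (V.a 0) (V.ext F) := by rw [V.cwa0, h0, sub_zero]
  have h2 := V.lift.us n (V.ext F)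
  simp only [VD.lift] at h2
  have h3 : V.s (cw (V.u (n+1)) (V.ext F)) =
      cw (V.u (n+1)) (V.b 0 (V.ext F)) - cw (V.a 0) (cw (V.u (n+1)) (V.ext F)) := by
    simp [VD.s, VD.b, dX_cw]
  have h4 : cw (V.a (n+1)) (V.ext F) = V.b (n+1) (V.ext F) := rfl
  simp only [VD.U, Derivation.add_apply, Derivation.smul_apply, smul_eq_mul, map_add,
      Derivation.leibniz, V.s_X, V.s_ps, h3, h1, h2, h4]
  ring

end Aux9

end PAnc

end PAsec

section PBsec


set_option linter.unusedSimpArgs false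
set_option linter.unusedSectionVars false

noncomputable section PBnc

namespace Aux9

open PowerSeries

section sums
variable {S : Type*} [CommRing S]

lemma sum_edge (f : ℕ → ℕ → S) (h : ∀ i j, f (i+1) (j+1) = 0) (k : ℕ) :
    ∑ i ∈ Finset.range (k+2), f i (k+2-1-i) = f 0 (k+1) + f (k+1) 0 := by
  rw [Finset.sum_range_succ, Finset.sum_range_succ']
  have : ∑ i ∈ Finset.range k, f (i+1) (k+2-1-(i+1)) = 0 := by
    apply Finset.sum_eq_zero
    intro i hi
    have hi := Finset.mem_range.1 hi
    have : k+2-1-(i+1) = (k-i-1)+1 := by omega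
    rw [this, h]
  rw [this]
  simp

lemma sum_lin (T : ℕ → ℕ → S) (hT : ∀ i j, T i j = T j i) (N M : ℕ) :
    2 * (∑ i ∈ Finset.range N, (2*(i:S)+1) * T (M+i) (N-1-i)
      - ∑ i ∈ Finset.range M, (2*(i:S)+1) * T (N+i) (M-1-i))
    = 2 * ((N:S)-M) * ∑ i ∈ Finset.range (N+M), T i (N+M-1-i) := by
  have h1 : ∑ i ∈ Finset.range N, (2*(i:S)+1) * T (M+i) (N-1-i)
      = ∑ a ∈ Finset.range N, (2*(N:S)-1-2*a) * T a (N+M-1-a) := by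
    rw [← Finset.sum_range_reflect]
    apply Finset.sum_congr rfl
    intro i hi
    have hi := Finset.mem_range.1 hi
    have e1 : ((N-1-i : ℕ) : S) = N - 1 - i := by
      rw [Nat.cast_sub (by omega), Nat.cast_sub (by omega)]; simp
    have e2 : N - 1 - (N-1-i) = i := by omega
    have e3 : M + (N-1-i) = N+M-1-i := by omega
    rw [e1, e2, e3, hT]; ring
  have h2 : ∑ i ∈ Finset.range M, (2*(i:S)+1) * T (N+i) (M-1-i)
      = - ∑ i ∈ Finset.range M, (2*(N:S)-1-2*((N+i:ℕ):S)) * T (N+i) (N+M-1-(N+i)) := by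
    rw [← Finset.sum_neg_distrib]
    apply Finset.sum_congr rfl
    intro i hi
    have hi := Finset.mem_range.1 hi
    have e3 : N+M-1-(N+i) = M-1-i := by omega
    rw [e3]; push_cast; ring
  have h3 : ∑ a ∈ Finset.range (N+M), (2*(N:S)-1-2*a) * T a (N+M-1-a)
     = ∑ a ∈ Finset.range (N+M), (2*(N:S)-1-2*((N:S)+M-1-a)) * T a (N+M-1-a) := by
    rw [← Finset.sum_range_reflect]
    apply Finset.sum_congr rfl
    intro i hi
    have hi := Finset.mem_range.1 hi
    have e1 : ((N+M-1-i : ℕ) : S) = N + M - 1 - i := by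
      rw [Nat.cast_sub (by omega), Nat.cast_sub (by omega)]; simp
    have e2 : N + M - 1 - (N+M-1-i) = i := by omega
    rw [e1, e2, hT]
  rw [h1, h2, sub_neg_eq_add, ← Finset.sum_range_add, two_mul]
  nth_rewrite 1 [h3]
  rw [← Finset.sum_add_distrib, Finset.mul_sum]
  apply Finset.sum_congr rfl
  intro i _
  ring

lemma sum_shift (T G : ℕ → ℕ → S) (c : S)
    (h00 : G 0 0 = 0) (h10 : ∀ i, G (i+1) 0 = -(c * ((2*(i:S)+3) * T i 0)))
    (h01 : ∀ j, G 0 (j+1) = -(c * ((2*(j:S)+3) * T 0 j)))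
    (h11 : ∀ i j, G (i+1) (j+1) = -(c * ((2*(i:S)+3) * T i (j+1) + (2*(j:S)+3) * T (i+1) j)))
    (M : ℕ) : ∑ i ∈ Finset.range (M+1), G i (M+1-1-i)
      = - (2 * ((M:S)+2) * c * ∑ i ∈ Finset.range M, T i (M-1-i)) := by
  let L : ℕ → ℕ → S := fun i j => Nat.casesOn i 0 (fun i => (2*(i:S)+3) * T i j)
  let L' : ℕ → ℕ → S := fun i j => Nat.casesOn j 0 (fun j => (2*(j:S)+3) * T i j)
  have hG : ∀ i j, G i j = -(c * (L i j + L' i j)) := by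
    intro i j
    cases i <;> cases j <;> simp [L, L', h00, h10, h01, h11]
  simp only [hG, Finset.sum_neg_distrib, ← Finset.mul_sum, Finset.sum_add_distrib]
  rw [Finset.sum_range_succ', Finset.sum_range_succ]
  have e1 : ∑ k ∈ Finset.range M, L (k+1) (M+1-1-(k+1))
      = ∑ k ∈ Finset.range M, (2*(k:S)+3) * T k (M-1-k) := by
    apply Finset.sum_congr rfl
    intro i hi
    have hi := Finset.mem_range.1 hi
    have : M+1-1-(i+1) = M-1-i := by omega
    rw [this]
  have e2 : ∑ k ∈ Finset.range M, L' k (M+1-1-k)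
      = ∑ k ∈ Finset.range M, (2*((M:S)-1-k)+3) * T k (M-1-k) := by
    apply Finset.sum_congr rfl
    intro i hi
    have hi := Finset.mem_range.1 hi
    have : M+1-1-i = (M-1-i)+1 := by omega
    have e1 : ((M-1-i : ℕ) : S) = M - 1 - i := by
      rw [Nat.cast_sub (by omega), Nat.cast_sub (by omega)]; simp
    rw [this]
    simp [L', e1]
  have e3 : L 0 (M+1-1-0) = 0 := rfl
  have e4 : L' M (M+1-1-M) = 0 := by
    have : M+1-1-M = 0 := by omega
    rw [this]
    rfl
  rw [e1, e2, e3, e4, add_zero, add_zero, ← Finset.sum_add_distrib, Finset.mul_sum, Finset.mul_sum]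
  congr 1
  apply Finset.sum_congr rfl
  intro i _
  ring

end sums

variable {R : Type*} [CommRing R] [Algebra ℚ R] (V : VD R)

local notation "ε" => (constantCoeff (R := R))

/-- lifted `T`. -/
def VD.T (F hb : R) (i j : ℕ) : R⟦X⟧ :=
  V.b i (V.ext F) * V.b j (V.ext F) + C hb * V.b i (V.b j (V.ext F))

def VD.EE (F hb : R) (M : ℕ) : R⟦X⟧ := ∑ i ∈ Finset.range M, V.T F hb i (M-1-i)

/-- symmetrized second derivative -/
def VD.W (F : R) : ℕ → ℕ → R
  | 0, 0 => V.a 0 (V.a 0 F)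
  | 0, (j+1) => V.a (j+1) (V.a 0 F)
  | (i+1), j => V.a (i+1) (V.a j F)

def VD.e (F hb : R) (M : ℕ) : R :=
  ∑ i ∈ Finset.range M, (V.a i F * V.a (M-1-i) F + hb * V.W F i (M-1-i))

lemma VD.T_symm (F hb : R) (i j : ℕ) : V.T F hb i j = V.T F hb j i := by
  simp only [VD.T]
  rw [V.b_comm i j]; ring

lemma VD.ε_p (F : R) (i : ℕ) : ε (V.b i (V.ext F)) = V.a i F := by
  cases i with
  | zero => rw [V.ε_b0, V.ε_ext, V.s_ext]; simp
  | succ i => rw [V.ε_bs, V.ε_ext]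

lemma VD.ε_W (F : R) (i j : ℕ) : ε (V.b i (V.b j (V.ext F))) = V.W F i j := by
  cases i with
  | zero =>
    cases j with
    | zero => rw [V.ε_b0, V.ε_p, V.s_p0]; simp [VD.W]
    | succ j => rw [V.b_comm, V.ε_bs, V.ε_p]; simp [VD.W]
  | succ i => rw [V.ε_bs, V.ε_p]; simp [VD.W]

lemma VD.ε_T (F hb : R) (i j : ℕ) :
    ε (V.T F hb i j) = V.a i F * V.a j F + hb * V.W F i j := by
  simp [VD.T, V.ε_p, V.ε_W]

lemma VD.ε_EE (F hb : R) (M : ℕ) : ε (V.EE F hb M) = V.e F hb M := by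
  simp [VD.EE, VD.e, V.ε_T]

section main
variable (F hb : R) (ha : ∀ i, V.a i hb = 0) (hu : ∀ i, V.u i hb = 0)

include ha in
lemma VD.b_hb (i : ℕ) : V.b i (C hb) = 0 := by
  cases i with
  | zero => exact V.b0_C hb
  | succ i => simp [VD.b, ha]

include ha in
lemma VD.s_hb : V.s (C hb) = 0 := by simp [VD.s, ha]

include ha hu in
lemma VD.U_hb (n : ℕ) : V.U n (C hb) = 0 := by
  simp [VD.U, hu, V.b_hb hb ha]

lemma VD.sW00 : V.s (V.b 0 (V.b 0 (V.ext F))) = 0 := by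
  rw [V.s_b0, V.s_p0, map_zero]

lemma VD.sW10 (i : ℕ) : V.s (V.b (i+1) (V.b 0 (V.ext F)))
    = - (C V.x * ((2*(i:R⟦X⟧)+3) * V.b i (V.b 0 (V.ext F)))) := by
  cases i with
  | zero => rw [V.s_b1, V.s_p0]; simp; ring
  | succ i => rw [V.s_b2, V.s_p0]; simp; ring

lemma nat_deriv {S : Type*} [CommRing S] [Algebra ℚ S] (D : Derivation ℚ S S) (i : ℕ) (f : S) :
    D ((2*(i:S)+3) * f) = (2*(i:S)+3) * D f := by
  have : (2*(i:S)+3) = ((2*i+3 : ℕ) : S) := by push_cast; ring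
  rw [this, Derivation.leibniz, Derivation.map_natCast, smul_zero, add_zero, smul_eq_mul]

lemma VD.sW11 (i j : ℕ) : V.s (V.b (i+1) (V.b (j+1) (V.ext F)))
    = - (C V.x * ((2*(i:R⟦X⟧)+3) * V.b i (V.b (j+1) (V.ext F))
       + (2*(j:R⟦X⟧)+3) * V.b (i+1) (V.b j (V.ext F)))) := by
  cases i with
  | zero =>
    rw [V.s_b1, V.s_ps, mul_assoc, map_neg, nat_deriv, Derivation.leibniz, V.b_Cx, V.a1x]
    simp [C_three]
    ring
  | succ i =>
    rw [V.s_b2, V.s_ps, mul_assoc, map_neg, nat_deriv, Derivation.leibniz, V.b_Cx, V.a2x]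
    simp
    ring

include ha in
lemma VD.s_EE0 : V.s (V.EE F hb 0) = 0 := by simp [VD.EE]

include ha in
lemma VD.s_EEs (M : ℕ) : V.s (V.EE F hb (M+1)) =
    - (2 * ((M:R⟦X⟧)+2) * C V.x * V.EE F hb M) := by
  simp only [VD.EE, map_sum]
  apply sum_shift (V.T F hb) (fun i j => V.s (V.T F hb i j)) (C V.x)
  · simp [VD.T, V.s_hb hb ha, V.s_p0, V.sW00]
  · intro i
    simp only [VD.T, map_add, Derivation.leibniz, V.s_hb hb ha, V.s_p0, V.s_ps, V.sW10, smul_eq_mul]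
    ring
  · intro j
    rw [V.T_symm, V.T_symm _ _ 0]
    simp only [VD.T, map_add, Derivation.leibniz, V.s_hb hb ha, V.s_p0, V.s_ps, V.sW10, smul_eq_mul]
    ring
  · intro i j
    simp only [VD.T, map_add, Derivation.leibniz, V.s_hb hb ha, V.s_ps, V.sW11, smul_eq_mul]
    ring

def VD.Dl (N : ℕ) : R⟦X⟧ := 8 * V.U N (V.ext F) + 4 * V.EE F hb N

lemma D_nat {S : Type*} [CommRing S] [Algebra ℚ S] (D : Derivation ℚ S S) (n : ℕ)
    (f : S) : D ((n : S) * f) = (n : S) * D f := by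
  rw [Derivation.leibniz, Derivation.map_natCast, smul_zero, add_zero, smul_eq_mul]

lemma D_8 {S : Type*} [CommRing S] [Algebra ℚ S] (D : Derivation ℚ S S) 
    (f : S) : D (8 * f) = 8 * D f := by
  exact_mod_cast D_nat D 8 f

lemma D_4 {S : Type*} [CommRing S] [Algebra ℚ S] (D : Derivation ℚ S S) 
    (f : S) : D (4 * f) = 4 * D f := by
  exact_mod_cast D_nat D 4 f

include ha in
lemma VD.s_Dl0 : V.s (V.Dl F hb 0) = 0 := by
  simp only [VD.Dl, map_add, D_8, D_4, V.s_U0, V.s_EE0 F hb ha]; simp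

include ha in
lemma VD.s_Dls (N : ℕ) : V.s (V.Dl F hb (N+1)) =
    C V.x * (- (2 * ((N:R⟦X⟧)+2) * V.Dl F hb N) + 8 * (X * V.b N (V.ext F))) := by
  simp only [VD.Dl, map_add, D_8, D_4, V.s_Us, V.s_EEs F hb ha]; ring

/-- the quadratic kernel -/
def VD.XX (i j k l : ℕ) : R⟦X⟧ :=
  V.b i (V.T F hb k l) * V.b j (V.ext F) + V.b i (V.ext F) * V.b j (V.T F hb k l)
   + C hb * V.b i (V.b j (V.T F hb k l))

include ha in
lemma VD.XX_symm (i j k l : ℕ) : V.XX F hb i j k l = V.XX F hb k l i j := by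
  simp only [VD.XX, VD.T, map_add, Derivation.leibniz, V.b_hb hb ha, smul_eq_mul, smul_zero,
    mul_zero, add_zero, map_zero]
  generalize V.ext F = G
  have c := V.b_comm
  have h1 : V.b k (V.b i (V.b j G)) = V.b i (V.b j (V.b k G)) := by rw [c k i, c k j]
  have h2 : V.b l (V.b i (V.b j G)) = V.b i (V.b j (V.b l G)) := by rw [c l i, c l j]
  have h3 : V.b j (V.b k (V.b l G)) = V.b k (V.b l (V.b j G)) := by rw [c j k, c j l]
  have h4 : V.b i (V.b k (V.b l G)) = V.b k (V.b l (V.b i G)) := by rw [c i k, c i l]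
  have h5 : V.b k (V.b l (V.b i (V.b j G))) = V.b i (V.b j (V.b k (V.b l G))) := by
    rw [c l i, c k i, c l j, c k j]
  rw [h5, h1, h2, h3, h4, c i k G, c i l G, c j k G, c j l G]
  ring

end main
end Aux9

end PBnc

end PBsec

section PCsec


set_option linter.unusedSimpArgs false
set_option linter.unusedSectionVars false

noncomputable section PCnc

namespace Aux9

open PowerSeries

variable {R : Type*} [CommRing R] [Algebra ℚ R] (V : VD R)

local notation "ε" => (constantCoeff (R := R))

/-- leading part of the first derivative of the constraint -/
def VD.k1 (hb : R) : ℕ → ℕ → R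
  | 0, 1 => 4 * V.x * hb
  | _, _ => 0

/-- leading part of the second derivative of the constraint -/
def VD.k2 (F hb : R) : ℕ → ℕ → ℕ → R
  | 0, 0, 0 => 0
  | 0, 0, 1 => 4 * hb * V.a 0 V.x + 8 * V.x * V.a 0 F
  | 0, 0, 2 => -(24 * V.x^2 * hb) + 8 * V.x * V.a 1 F
  | 0, 0, (N+3) => 8 * V.x * V.a (N+2) F
  | 1, 0, 1 => -(12 * V.x^2 * hb)
  | 0, 1, 1 => -(12 * V.x^2 * hb)
  | _, _, _ => 0

section main
variable (F hb : R) (ha : ∀ i, V.a i hb = 0) (hu : ∀ i, V.u i hb = 0)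
  (I J : Ideal R) (haI : ∀ i f, f ∈ I → V.a i f ∈ I)
  (hpI : ∀ i f, f ∈ I → V.a i F * f ∈ J) (hhI : ∀ f, f ∈ I → hb * f ∈ J)
  (hyp : ∀ N, 8 * V.u N F + 4 * V.e F hb N + (if N = 0 then hb else 0) ∈ I)

lemma VD.ε_Dl (N : ℕ) : ε (V.Dl F hb N) = 8 * V.u N F + 4 * V.e F hb N := by
  simp only [VD.Dl, map_add, map_mul, V.ε_U, V.ε_EE, V.ε_ext, map_ofNat]

include hyp in
lemma VD.Dl_mem (N : ℕ) : ε (V.Dl F hb N) + (if N = 0 then hb else 0) ∈ I := by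
  rw [V.ε_Dl]; exact hyp N

include ha haI hyp in
lemma VD.a_Dl_mem (i N : ℕ) : V.a i (ε (V.Dl F hb N)) ∈ I := by
  have h := haI i _ (V.Dl_mem F hb I hyp N)
  rw [map_add] at h
  have : V.a i (if N = 0 then hb else 0) = 0 := by split_ifs <;> simp [ha]
  rwa [this, add_zero] at h

include ha haI hyp in
lemma VD.eps1 (i N : ℕ) : ε (V.b i (V.Dl F hb N)) - V.k1 hb i N ∈ I := by
  cases i with
  | succ i =>
    rw [V.ε_bs]
    simpa [VD.k1] using V.a_Dl_mem F hb ha I haI hyp (i+1) N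
  | zero =>
    rw [V.ε_b0]
    have h := V.a_Dl_mem F hb ha I haI hyp 0 N
    match N with
    | 0 =>
      rw [V.s_Dl0 F hb ha]
      simpa [VD.k1] using h
    | 1 =>
      have h0 := V.Dl_mem F hb I hyp 0
      rw [V.s_Dls F hb ha]
      simp only [VD.k1, map_mul, map_add, map_neg, map_ofNat, constantCoeff_C, constantCoeff_X]
      simp only [if_true] at h0
      have := I.sub_mem h (I.mul_mem_left (4 * V.x) h0)
      convert this using 1
      simp
      ring
    | (n+2) =>
      have h0 := V.Dl_mem F hb I hyp (n+1)
      rw [V.s_Dls F hb ha]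
      simp only [VD.k1, map_mul, map_add, map_neg, map_ofNat, constantCoeff_C, constantCoeff_X]
      simp only [Nat.succ_ne_zero, if_false, add_zero] at h0
      have := I.sub_mem h (I.mul_mem_left (2 * (n+3) * V.x) h0)
      convert this using 1
      simp
      ring

include ha haI hyp in
lemma VD.a_eps1 (k i N : ℕ) : V.a k (ε (V.b i (V.Dl F hb N))) - V.a k (V.k1 hb i N) ∈ I := by
  rw [← map_sub]
  exact haI _ _ (V.eps1 F hb ha I haI hyp i N)

include ha haI hyp in
lemma VD.eps2s (i j N : ℕ) : ε (V.b (i+1) (V.b j (V.Dl F hb N))) - V.k2 F hb (i+1) j N ∈ I := by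
  rw [V.ε_bs]
  have h := V.a_eps1 F hb ha I haI hyp (i+1) j N
  convert h using 2
  have e4 : V.a (i+1) (4 * V.x * hb) = 4 * V.a (i+1) V.x * hb := by
    rw [mul_assoc, D_4, Derivation.leibniz, ha]; simp; ring
  match i, j, N with
  | 0, 0, 1 => simp only [VD.k1, VD.k2, e4]; rw [zero_add, V.a1x]; ring
  | (i+1), 0, 1 => simp only [VD.k1, VD.k2, e4]; rw [V.a2x]; ring
  | i, (j+1), N => simp [VD.k1, VD.k2]
  | i, 0, 0 => simp [VD.k1, VD.k2]
  | i, 0, (n+2) => simp [VD.k1, VD.k2]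

lemma VD.k2_symm (i j N : ℕ) : V.k2 F hb i j N = V.k2 F hb j i N := by
  unfold VD.k2
  split <;> simp_all

include ha haI hyp in
lemma VD.eps200 (N : ℕ) : ε (V.b 0 (V.b 0 (V.Dl F hb N))) - V.k2 F hb 0 0 N ∈ I := by
  rw [V.ε_b0, V.s_b0]
  have h := V.a_eps1 F hb ha I haI hyp 0 0 N
  have e4 : V.a 0 (4 * V.x * hb) = 4 * V.a 0 V.x * hb := by
    rw [mul_assoc, D_4, Derivation.leibniz, ha]; simp; ring
  cases N with
  | zero =>
    rw [V.s_Dl0 F hb ha]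
    simpa [VD.k1, VD.k2] using h
  | succ N =>
    have h1 := V.eps1 F hb ha I haI hyp 0 N
    have e : ε (V.b 0 (V.s (V.Dl F hb (N+1)))) =
        V.x * (-(2 * ((N:R)+2)) * ε (V.b 0 (V.Dl F hb N)) + 8 * V.a N F) := by
      rw [V.s_Dls F hb ha, Derivation.leibniz, V.b0_C, smul_zero, add_zero, map_add, D_8]
      have e2 : (2 * ((N:R⟦X⟧)+2)) = ((2*(N+2) : ℕ) : R⟦X⟧) := by push_cast; ring
      rw [e2, map_neg, D_nat, Derivation.leibniz]
      have e3 : V.b 0 X = 1 := dX_X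
      rw [e3]
      have c2 : ε 2 = 2 := map_ofNat _ 2
      have c8 : ε 8 = 8 := map_ofNat _ 8
      simp [V.ε_p, c2, c8]
    rw [e]
    have h2 := I.sub_mem h (I.mul_mem_left (2 * (N+2) * V.x) h1)
    match N with
    | 0 => 
      simp only [VD.k1, VD.k2, e4] at h2 ⊢
      convert h2 using 1
      simp; ring
    | 1 => 
      simp only [VD.k1, VD.k2, e4] at h2 ⊢
      convert h2 using 1
      simp; ring
    | (n+2) =>
      simp only [VD.k1, VD.k2, e4] at h2 ⊢
      convert h2 using 1
      simp; ring

include ha haI hyp in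
lemma VD.eps2 (i j N : ℕ) : ε (V.b i (V.b j (V.Dl F hb N))) - V.k2 F hb i j N ∈ I := by
  match i, j with
  | (i+1), j => exact V.eps2s F hb ha I haI hyp i j N
  | 0, 0 => exact V.eps200 F hb ha I haI hyp N
  | 0, (j+1) =>
    rw [V.b_comm, V.k2_symm]
    exact V.eps2s F hb ha I haI hyp j 0 N

def VD.kf (N i j : ℕ) : R :=
  V.k1 hb i N * V.a j F + V.a i F * V.k1 hb j N + hb * V.k2 F hb i j N

def VD.K (N M : ℕ) : R := ∑ i ∈ Finset.range M, V.kf F hb N i (M-1-i)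

lemma VD.kf11 (N i j : ℕ) : V.kf F hb N (i+1) (j+1) = 0 := by
  simp [VD.kf, VD.k1, VD.k2]

lemma VD.kfN0 (i j : ℕ) : V.kf F hb 0 i j = 0 := by
  match i, j with
  | 0, 0 => simp [VD.kf, VD.k1, VD.k2]
  | 0, (j+1) => simp [VD.kf, VD.k1, VD.k2]
  | (i+1), 0 => simp [VD.kf, VD.k1, VD.k2]
  | (i+1), (j+1) => simp [VD.kf, VD.k1, VD.k2]

lemma VD.K_symm (N M : ℕ) : V.K F hb N M = V.K F hb M N := by
  have z1 : ∀ M, V.K F hb 0 M = 0 := fun M => by simp [VD.K, V.kfN0]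
  have z2 : ∀ M, V.K F hb M 0 = 0 := fun M => by simp [VD.K]
  have t : ∀ N k, V.K F hb N (k+2) = V.kf F hb N 0 (k+1) + V.kf F hb N (k+1) 0 := fun N k =>
    sum_edge (V.kf F hb N) (V.kf11 F hb N) k
  have o : ∀ N, V.K F hb N 1 = V.kf F hb N 0 0 := fun N => by simp [VD.K]
  have m : ∀ k, V.K F hb 1 (k+2) = V.K F hb (k+2) 1 := by
    intro k
    rw [t, o]
    match k with
    | 0 => simp [VD.kf, VD.k1, VD.k2]; ring
    | (k+1) => simp [VD.kf, VD.k1, VD.k2]; ring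
  match N, M with
  | 0, M => rw [z1, z2]
  | N, 0 => rw [z1, z2]
  | 1, 1 => rfl
  | 1, (k+2) => exact m k
  | (k+2), 1 => exact (m k).symm
  | (k+2), (l+2) => rw [t, t]; simp [VD.kf, VD.k1, VD.k2]

/-- the kernel applied to a general series -/
def VD.Y (D : R⟦X⟧) (i j : ℕ) : R⟦X⟧ :=
  V.b i D * V.b j (V.ext F) + V.b i (V.ext F) * V.b j D + C hb * V.b i (V.b j D)

lemma VD.Y_add (D E : R⟦X⟧) (i j : ℕ) : V.Y F hb (D+E) i j = V.Y F hb D i j + V.Y F hb E i j := by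
  simp only [VD.Y, map_add]; ring

lemma VD.Y_8 (D : R⟦X⟧) (i j : ℕ) : V.Y F hb (8 * D) i j = 8 * V.Y F hb D i j := by
  simp only [VD.Y, D_8]; ring

lemma VD.Y_4 (D : R⟦X⟧) (i j : ℕ) : V.Y F hb (4 * D) i j = 4 * V.Y F hb D i j := by
  simp only [VD.Y, D_4]; ring

lemma VD.Y_EE (i j N : ℕ) : V.Y F hb (V.EE F hb N) i j =
    ∑ k ∈ Finset.range N, V.XX F hb i j k (N-1-k) := by
  simp only [VD.Y, VD.EE, VD.XX, map_sum, Finset.sum_mul, Finset.mul_sum, Finset.sum_add_distrib]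

include ha hu in
lemma VD.U_T (N i j : ℕ) : V.U N (V.T F hb i j) = V.Y F hb (V.U N (V.ext F)) i j
    - (2*(i:R⟦X⟧)+1) * V.T F hb (N+i) j - (2*(j:R⟦X⟧)+1) * V.T F hb i (N+j) := by
  have e : ∀ f, V.b i ((2*(j:R⟦X⟧)+1) * f) = (2*(j:R⟦X⟧)+1) * V.b i f := by
    intro f
    have e2 : (2*(j:R⟦X⟧)+1) = ((2*j+1 : ℕ) : R⟦X⟧) := by push_cast; ring
    rw [e2, D_nat]
  simp only [VD.T, VD.Y, map_add, Derivation.leibniz, V.U_hb hb ha hu, V.U_b, smul_eq_mul, map_sub, e]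
  ring

include ha hu in
lemma VD.U_EE (N M : ℕ) : 8 * V.U N (V.EE F hb M) =
    ∑ i ∈ Finset.range M, V.Y F hb (V.Dl F hb N) i (M-1-i)
    - 4 * ∑ i ∈ Finset.range M, ∑ k ∈ Finset.range N, V.XX F hb i (M-1-i) k (N-1-k)
    - 8 * (2 * ∑ i ∈ Finset.range M, (2*(i:R⟦X⟧)+1) * V.T F hb (N+i) (M-1-i)) := by
  have h1 : ∑ i ∈ Finset.range M, (2*((M-1-i:ℕ):R⟦X⟧)+1) * V.T F hb i (N+(M-1-i))
     = ∑ i ∈ Finset.range M, (2*(i:R⟦X⟧)+1) * V.T F hb (N+i) (M-1-i) := by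
    rw [← Finset.sum_range_reflect]
    apply Finset.sum_congr rfl
    intro i hi
    have hi := Finset.mem_range.1 hi
    have e2 : M - 1 - (M-1-i) = i := by omega
    rw [e2, V.T_symm]
  rw [two_mul (∑ i ∈ Finset.range M, _)]
  nth_rewrite 2 [← h1]
  simp only [VD.Dl, V.Y_add, V.Y_8, V.Y_4, V.Y_EE, Finset.sum_add_distrib, ← Finset.mul_sum]
  rw [VD.EE, map_sum]
  simp only [V.U_T F hb ha hu, Finset.sum_sub_distrib]
  ring

include ha hu in
lemma VD.U_comm (N M : ℕ) : 8 * (V.U N (V.EE F hb M) - V.U M (V.EE F hb N)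
      - 2 * ((N:R⟦X⟧) - M) * V.EE F hb (N+M)) =
    ∑ i ∈ Finset.range M, V.Y F hb (V.Dl F hb N) i (M-1-i)
    - ∑ i ∈ Finset.range N, V.Y F hb (V.Dl F hb M) i (N-1-i) := by
  have h1 := V.U_EE F hb ha hu N M
  have h2 := V.U_EE F hb ha hu M N
  have h3 := sum_lin (V.T F hb) (V.T_symm F hb) N M
  have h4 : ∑ i ∈ Finset.range M, ∑ k ∈ Finset.range N, V.XX F hb i (M-1-i) k (N-1-k)
     = ∑ i ∈ Finset.range N, ∑ k ∈ Finset.range M, V.XX F hb i (N-1-i) k (M-1-k) := by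
    rw [Finset.sum_comm]
    apply Finset.sum_congr rfl; intro k _
    apply Finset.sum_congr rfl; intro i _
    rw [V.XX_symm F hb ha]
  rw [← VD.EE] at h3
  linear_combination h1 - h2 - 4 * h4 + 8 * h3

include ha haI hyp hpI hhI in
lemma VD.Y_mem (N i j : ℕ) : ε (V.Y F hb (V.Dl F hb N) i j) - V.kf F hb N i j ∈ J := by
  have h1 := hpI j _ (V.eps1 F hb ha I haI hyp i N)
  have h2 := hpI i _ (V.eps1 F hb ha I haI hyp j N)
  have h3 := hhI _ (V.eps2 F hb ha I haI hyp i j N)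
  have := J.add_mem (J.add_mem h1 h2) h3
  convert this using 1
  simp only [VD.Y, VD.kf, map_add, map_mul, V.ε_p, constantCoeff_C]
  ring

include ha hu haI hyp hpI hhI in
theorem VD.closed (N M : ℕ) : 8 * (V.u N (V.e F hb M) - V.u M (V.e F hb N)
      - 2 * ((N:R) - M) * V.e F hb (N+M)) ∈ J := by
  have h := congrArg ε (V.U_comm F hb ha hu N M)
  simp only [map_mul, map_sub, V.ε_U, V.ε_EE, map_ofNat, map_natCast, map_sum] at h
  rw [h]
  have key : ∀ N M, (∑ i ∈ Finset.range M, ε (V.Y F hb (V.Dl F hb N) i (M-1-i))) - V.K F hb N M ∈ J := by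
    intro N M
    rw [VD.K, ← Finset.sum_sub_distrib]
    exact J.sum_mem fun i _ => V.Y_mem F hb ha I J haI hpI hhI hyp N i _
  have := J.sub_mem (key N M) (key M N)
  rw [V.K_symm F hb N M] at this
  convert this using 1
  ring

end main
end Aux9

end PCnc

end PCsec

section PDsec


set_option linter.unusedSimpArgs false
set_option linter.unusedSectionVars false

noncomputable section PDnc

namespace Aux9

abbrev A := MvPolynomial (Option ℕ) ℚ

def ell : A := MvPolynomial.X none
def xx : A := MvPolynomial.X (some 0)
def xi : ℕ → A
  | 0 => 1
  | (l+1) => MvPolynomial.X (some (l+1))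

@[simp] lemma xi_zero : xi 0 = 1 := rfl

def mkD (cl cx : A) (c : ℕ → A) : Derivation ℚ A A :=
  MvPolynomial.mkDerivation ℚ (fun o => match o with
    | none => cl
    | some 0 => cx
    | some (l+1) => c (l+1))

lemma mkD_ell (cl cx : A) (c : ℕ → A) : mkD cl cx c ell = cl := by
  simp [mkD, ell]

lemma mkD_xx (cl cx : A) (c : ℕ → A) : mkD cl cx c xx = cx := by
  simp [mkD, xx]

lemma mkD_xi (cl cx : A) (c : ℕ → A) (hc : c 0 = 0) (l : ℕ) : mkD cl cx c (xi l) = c l := by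
  cases l with
  | zero => simp [hc, xi]
  | succ l => simp [mkD, xi]

lemma der_ext (D E : Derivation ℚ A A) (h1 : D ell = E ell) (h2 : D xx = E xx)
    (h3 : ∀ l, D (xi l) = E (xi l)) : D = E := by
  apply MvPolynomial.derivation_ext
  intro i
  match i with
  | none => exact h1
  | some 0 => exact h2
  | some (l+1) => exact h3 (l+1)

lemma comm_ext (D E G : Derivation ℚ A A) (h1 : D (E ell) - E (D ell) = G ell)
    (h2 : D (E xx) - E (D xx) = G xx)
    (h3 : ∀ l, D (E (xi l)) - E (D (xi l)) = G (xi l)) (f : A) :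
    D (E f) = E (D f) + G f := by
  have : ⁅D, E⁆ = G := by
    apply der_ext <;> simp only [Derivation.commutator_apply] <;> assumption
  rw [← this, Derivation.commutator_apply]; ring

def da : ℕ → Derivation ℚ A A
  | 0 => mkD (-3 * xi 1 * xx) (3 * xi 1 * xx^2)
      (fun l => -(2*(l:A)+3) * xx * xi (l+1) + 3 * xx * xi 1 * xi l)
  | (k+1) => mkD (if k = 0 then 3 * xx else 0) (if k = 0 then -3 * xx^2 else 0)
      (fun l => (if l = k then (2*(k:A)+3)*xx else 0) - if k = 0 then 3 * xx * xi l else 0)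

def du (N : ℕ) : Derivation ℚ A A :=
  mkD (if N = 0 then 3 else 0) (if N = 0 then -3 * xx else 0)
      (fun l => (if N ≤ l then (2*(l:A)+3)*xi (l-N) else 0) - if N = 0 then 3 * xi l else 0)

lemma da0_ell : da 0 ell = -3 * xi 1 * xx := by
  rw [da, mkD_ell]
lemma da0_xx : da 0 xx = 3 * xi 1 * xx^2 := by
  rw [da, mkD_xx]
lemma da0_xi (l : ℕ) : da 0 (xi l) = -(2*(l:A)+3) * xx * xi (l+1) + 3 * xx * xi 1 * xi l := by
  rw [da, mkD_xi]
  simp only [Nat.cast_zero, xi_zero]; ring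
lemma das_ell (k : ℕ) : da (k+1) ell = if k = 0 then 3 * xx else 0 := by
  rw [da, mkD_ell]
lemma das_xx (k : ℕ) : da (k+1) xx = if k = 0 then -3 * xx^2 else 0 := by
  rw [da, mkD_xx]
lemma das_xi (k l : ℕ) : da (k+1) (xi l) =
    (if l = k then (2*(k:A)+3)*xx else 0) - if k = 0 then 3 * xx * xi l else 0 := by
  rw [da, mkD_xi]
  rcases k with _ | k <;> simp
lemma du_ell (N : ℕ) : du N ell = if N = 0 then 3 else 0 := by
  rw [du, mkD_ell]
lemma du_xx (N : ℕ) : du N xx = if N = 0 then -3 * xx else 0 := by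
  rw [du, mkD_xx]
lemma du_xi (N l : ℕ) : du N (xi l) =
    (if N ≤ l then (2*(l:A)+3)*xi (l-N) else 0) - if N = 0 then 3 * xi l else 0 := by
  rw [du, mkD_xi]
  rcases N with _ | N <;> simp

lemma D_3 {S : Type*} [CommRing S] [Algebra ℚ S] (D : Derivation ℚ S S) : D 3 = 0 := by
  exact_mod_cast Derivation.map_natCast D 3

lemma D_2 {S : Type*} [CommRing S] [Algebra ℚ S] (D : Derivation ℚ S S) : D 2 = 0 := by
  exact_mod_cast Derivation.map_natCast D 2

lemma D_ite {S : Type*} [CommRing S] [Algebra ℚ S] (D : Derivation ℚ S S) (p : Prop) [Decidable p]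
    (f g : S) : D (if p then f else g) = if p then D f else D g := by
  split_ifs <;> rfl

lemma D_sq {S : Type*} [CommRing S] [Algebra ℚ S] (D : Derivation ℚ S S) (f : S) :
    D (f^2) = 2 * f * D f := by
  rw [pow_two, Derivation.leibniz]; simp; ring

end Aux9

end PDnc

end PDsec

section PD1sec


set_option linter.unusedSimpArgs false
set_option linter.unusedSectionVars false

noncomputable section PD1nc

namespace Aux9

lemma da1_ell : da 1 ell = 3 * xx := by rw [das_ell]; simp
lemma da2_ell (k : ℕ) : da (k+2) ell = 0 := by rw [das_ell]; simp
lemma da1_xx : da 1 xx = -3 * xx^2 := by rw [das_xx]; simp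
lemma da2_xx (k : ℕ) : da (k+2) xx = 0 := by rw [das_xx]; simp
lemma da1_xi (l : ℕ) : da 1 (xi l) = (if l = 0 then 3 * xx else 0) - 3 * xx * xi l := by
  rw [das_xi]; simp
lemma da2_xi (k l : ℕ) : da (k+2) (xi l) = if l = k+1 then (2*(k:A)+5) * xx else 0 := by
  rw [das_xi]; simp only [Nat.succ_ne_zero, if_false, sub_zero]; push_cast; ring_nf
lemma du0_ell : du 0 ell = 3 := by rw [du_ell]; simp
lemma du1_ell (k : ℕ) : du (k+1) ell = 0 := by rw [du_ell]; simp
lemma du0_xx : du 0 xx = -3 * xx := by rw [du_xx]; simp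
lemma du1_xx (k : ℕ) : du (k+1) xx = 0 := by rw [du_xx]; simp
lemma du0_xi (l : ℕ) : du 0 (xi l) = 2 * (l:A) * xi l := by
  rw [du_xi]; simp; ring
lemma du1_xi (k l : ℕ) : du (k+1) (xi l) = if k+1 ≤ l then (2*(l:A)+3) * xi (l-(k+1)) else 0 := by
  rw [du_xi]; simp

lemma D_mul {S : Type*} [CommRing S] [Algebra ℚ S] (D : Derivation ℚ S S) (f g : S) :
    D (f * g) = f * D g + g * D f := by
  rw [Derivation.leibniz, smul_eq_mul, smul_eq_mul]

lemma D_5 {S : Type*} [CommRing S] [Algebra ℚ S] (D : Derivation ℚ S S) : D 5 = 0 := by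
  exact_mod_cast Derivation.map_natCast D 5

lemma da_aa_aux (i j : ℕ) (hij : i ≤ j) (f : A) : da (i+1) (da (j+1) f) = da (j+1) (da (i+1) f) := by
  have := comm_ext (da (i+1)) (da (j+1)) 0
  simp only [Derivation.zero_apply, add_zero] at this
  apply this <;> clear this
  all_goals
    intros
    rcases i with _ | i <;> rcases j with _ | j
    all_goals
      simp only [zero_add, add_assoc, Nat.reduceAdd, da1_ell, da2_ell, da1_xx, da2_xx, da1_xi, da2_xi, D_ite, D_sq, D_mul, map_sub, map_add, map_neg, D_2, D_3, D_5, Derivation.map_natCast, map_zero, smul_eq_mul]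
      try ring1
  · split_ifs <;> first | omega | ring
  · omega
  · split_ifs <;> first | omega | ring

lemma da_aa (i j : ℕ) (f : A) : da (i+1) (da (j+1) f) = da (j+1) (da (i+1) f) := by
  rcases le_total i j with h | h
  · exact da_aa_aux i j h f
  · exact (da_aa_aux j i h f).symm

lemma da_a0 (i : ℕ) (f : A) :
    da (i+1) (da 0 f) = da 0 (da (i+1) f) - (2*i+3) * xx * da i f := by
  have := comm_ext (da (i+1)) (da 0) (-((2*i+3) * xx) • da i)
  simp only [Derivation.smul_apply, smul_eq_mul] at this
  rw [this]
  · ring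
  all_goals
    clear this
    intros
    rcases i with _ | _ | i
    all_goals
      simp only [zero_add, add_assoc, Nat.reduceAdd, da0_ell, da0_xx, da0_xi, da1_ell, da2_ell, da1_xx, da2_xx, da1_xi, da2_xi, D_ite, D_sq, D_mul, map_sub, map_add, map_neg, D_2, D_3, D_5, Derivation.map_natCast, map_zero, smul_eq_mul]
      try push_cast
      try ring1
  · split_ifs <;> first | omega | ring1 | (subst_vars; simp only [xi_zero, Nat.cast_zero]; ring1)
  · split_ifs <;> first | omega | ring1 | (subst_vars; simp only [xi_zero, Nat.cast_zero]; ring1)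
  · rename_i l
    have e : (l + 1 = i + 2) ↔ (l = i + 1) := by omega
    try simp only [e]
    split_ifs <;> first | omega | ring1 | (subst_vars; push_cast; ring1)

lemma du_a (n i : ℕ) (f : A) :
    du n (da (i+1) f) = da (i+1) (du n f) - (2*i+3) * da (n+i+1) f := by
  have := comm_ext (du n) (da (i+1)) (-(2*(i:A)+3) • da (n+i+1))
  simp only [Derivation.smul_apply, smul_eq_mul] at this
  rw [this]
  · ring
  all_goals
    clear this
    intros
    rcases n with _ | n <;> rcases i with _ | i
    all_goals
      simp only [zero_add, add_zero, ← add_assoc, Nat.reduceAdd, du0_ell, du0_xx, du0_xi, du1_ell, du1_xx, du1_xi, da1_ell, da2_ell, da1_xx, da2_xx, da1_xi, da2_xi, D_ite, D_sq, D_mul, map_sub, map_add, map_neg, D_2, D_3, D_5, Derivation.map_natCast, map_zero, smul_eq_mul]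
      try simp only [add_right_comm _ 1 _, add_assoc, Nat.reduceAdd, da2_ell, da2_xx, da2_xi]
      try push_cast
      try ring1
  · split_ifs <;> first | omega | ring1 | (subst_vars; simp only [xi_zero, Nat.cast_zero]; ring1)
  · split_ifs <;> first | omega | ring1 | (subst_vars; push_cast; ring1)
  · rename_i l
    rcases lt_trichotomy l (n+1) with h | rfl | h
    · have e1 : ¬ (n+1 ≤ l) := by omega
      have e2 : ¬ (l = n+1) := by omega
      simp only [if_neg e1, if_neg e2]
      split_ifs <;> ring
    · simp; ring
    · have e1 : (n+1 ≤ l) := by omega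
      have e2 : ¬ (l = n+1) := by omega
      have e3 : ¬ (l - (n+1) = 0) := by omega
      simp only [if_pos e1, if_neg e2, if_neg e3]
      split_ifs <;> ring
  · rename_i l
    have e : l - (n+1) = i+1 ↔ l = n+i+2 := by omega
    try simp only [e]
    split_ifs <;> first | omega | ring1 | (subst_vars; push_cast; ring1)

lemma du_0 (f : A) : du 0 (da 0 f) = da 0 (du 0 f) - da 0 f := by
  have := comm_ext (du 0) (da 0) (-(1:A) • da 0)
  simp only [Derivation.smul_apply, smul_eq_mul] at this
  rw [this]
  · ring
  all_goals
    clear this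
    intros
    simp only [du0_ell, du0_xx, du0_xi, da0_ell, da0_xx, da0_xi, D_ite, D_sq, D_mul, map_sub, map_add, map_neg, D_2, D_3, Derivation.map_natCast, map_zero, smul_eq_mul]
    push_cast
    ring1

lemma du_s (n : ℕ) (f : A) :
    du (n+1) (da 0 f) = da 0 (du (n+1) f) - da (n+1) f - 2*(n+2)*xx*du n f := by
  have := comm_ext (du (n+1)) (da 0) (-(1:A) • da (n+1) - (2*((n:A)+2)*xx) • du n)
  simp only [Derivation.smul_apply, Derivation.sub_apply, smul_eq_mul] at this
  rw [this]
  · ring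
  all_goals
    clear this
    intros
    rcases n with _ | n
    all_goals
      simp only [zero_add, add_zero, add_assoc, Nat.reduceAdd, da0_ell, da0_xx, da0_xi, du0_ell, du0_xx, du0_xi, du1_ell, du1_xx, du1_xi, da1_ell, da2_ell, da1_xx, da2_xx, da1_xi, da2_xi, D_ite, D_sq, D_mul, map_sub, map_add, map_neg, D_2, D_3, D_5, Derivation.map_natCast, map_zero, smul_eq_mul]
      try push_cast
  · simp only [xi_zero]; ring
  · ring
  · simp only [xi_zero]; ring
  · ring
  · rename_i l
    have h1 := du1_xi 0
    simp only [zero_add] at h1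
    try simp only [h1]
    rcases l with _ | l
    · simp
      try ring
    · simp
      try ring
  · rename_i l
    have h1 := du1_xi (n+1)
    simp only [zero_add, add_assoc, Nat.reduceAdd] at h1
    try simp only [h1]
    rcases lt_trichotomy l (n+1) with h | rfl | h
    · rw [if_neg (by omega), if_neg (by omega), if_neg (by omega), if_neg (by omega), if_neg (by omega)]
      ring
    · simp; ring
    · obtain ⟨m, rfl⟩ := Nat.exists_eq_add_of_le h
      have h2 : n + 2 ≤ (n+1).succ + m + 1 := by omega
      have h3 : n + 2 ≤ (n+1).succ + m := by omega
      have h4 : n + 1 ≤ (n+1).succ + m := by omega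
      have h5 : ¬ ( (n+1).succ + m  = n+1) := by omega
      have h6 : (n+1).succ + m + 1 - (n+2) = m+1 := by omega
      have h7 : (n+1).succ + m - (n+2) = m := by omega
      have h8 : (n+1).succ + m - (n+1) = m+1 := by omega
      rw [if_pos h4, if_pos h3, if_pos h3, if_neg h5, if_pos h4, h7, h8]
      push_cast
      ring

/-- the concrete structure -/
def VA : VD A where
  a := da
  u := du
  x := xx
  aa := da_aa
  a0 := da_a0
  ua := du_a
  u0 := du_0
  us := du_s
  a1x := by rw [da1_xx]; ring
  a2x j := da2_xx j

end Aux9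

end PD1nc

end PD1sec

section PE1sec


set_option linter.unusedSimpArgs false
set_option linter.unusedSectionVars false

noncomputable section PE1nc

namespace Aux9

open PowerSeries

def Eul : Derivation ℚ A A := mkD 1 (-xx) (fun _ => 0)
def wt : Derivation ℚ A A := mkD 0 0 (fun l => (l:A) * xi l)
def dell : Derivation ℚ A A := mkD 1 0 (fun _ => 0)

lemma Eul_ell : Eul ell = 1 := by rw [Eul, mkD_ell]
lemma Eul_xx : Eul xx = -xx := by rw [Eul, mkD_xx]
lemma Eul_xi (l : ℕ) : Eul (xi l) = 0 := by rw [Eul, mkD_xi]; rfl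
lemma wt_ell : wt ell = 0 := by rw [wt, mkD_ell]
lemma wt_xx : wt xx = 0 := by rw [wt, mkD_xx]
lemma wt_xi (l : ℕ) : wt (xi l) = (l:A) * xi l := by rw [wt, mkD_xi]; simp
lemma dell_ell : dell ell = 1 := by rw [dell, mkD_ell]
lemma dell_xx : dell xx = 0 := by rw [dell, mkD_xx]
lemma dell_xi (l : ℕ) : dell (xi l) = 0 := by rw [dell, mkD_xi]; rfl

lemma Eul_da (i : ℕ) (f : A) : Eul (da i f) = da i (Eul f) - da i f := by
  have := comm_ext Eul (da i) (-(1:A) • da i)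
  simp only [Derivation.smul_apply, smul_eq_mul] at this
  rw [this]
  · ring
  all_goals
    clear this
    intros
    rcases i with _ | _ | i
    all_goals
      simp only [Eul_ell, Eul_xx, Eul_xi, zero_add, add_assoc, Nat.reduceAdd, da0_ell, da0_xx, da0_xi, da1_ell, da2_ell, da1_xx, da2_xx, da1_xi, da2_xi, D_ite, D_sq, D_mul, map_sub, map_add, map_neg, D_2, D_3, D_5, Derivation.map_natCast, map_zero, smul_eq_mul, Derivation.map_one_eq_zero]
      try split_ifs
      all_goals ring1

lemma dell_da (i : ℕ) (f : A) : dell (da i f) = da i (dell f) := by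
  have := comm_ext dell (da i) 0
  simp only [Derivation.zero_apply, add_zero] at this
  apply this
  all_goals
    clear this
    intros
    rcases i with _ | _ | i
    all_goals
      simp only [dell_ell, dell_xx, dell_xi, zero_add, add_assoc, Nat.reduceAdd, da0_ell, da0_xx, da0_xi, da1_ell, da2_ell, da1_xx, da2_xx, da1_xi, da2_xi, D_ite, D_sq, D_mul, map_sub, map_add, map_neg, D_2, D_3, D_5, Derivation.map_natCast, map_zero, smul_eq_mul, Derivation.map_one_eq_zero]
      try split_ifs
      all_goals ring1

lemma du0_eq (f : A) : du 0 f = 3 * Eul f + 2 * wt f := by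
  have : du 0 = (3:A) • Eul + (2:A) • wt := by
    apply der_ext
    · simp [du0_ell, Eul_ell, wt_ell]
    · simp [du0_xx, Eul_xx, wt_xx]
    · intro l
      simp [du0_xi, Eul_xi, wt_xi]; ring
  rw [this]
  simp

/-! ### stabilization of sequences of derivations -/

lemma stab (D : ℕ → Derivation ℚ A A) (E : Derivation ℚ A A)
    (h1 : ∃ K, ∀ L ≥ K, D L ell = E ell) (h2 : ∃ K, ∀ L ≥ K, D L xx = E xx)
    (h3 : ∀ l, ∃ K, ∀ L ≥ K, D L (xi l) = E (xi l)) (f : A) : ∃ K, ∀ L ≥ K, D L f = E f := by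
  induction f using MvPolynomial.induction_on with
  | C c =>
    refine ⟨0, fun L _ => ?_⟩
    have : (MvPolynomial.C c : A) = algebraMap ℚ A c := rfl
    rw [this, Derivation.map_algebraMap, Derivation.map_algebraMap]
  | add p q hp hq =>
    obtain ⟨K1, h1⟩ := hp
    obtain ⟨K2, h2⟩ := hq
    exact ⟨max K1 K2, fun L hL => by
      rw [map_add, map_add, h1 L (le_trans (le_max_left _ _) hL), h2 L (le_trans (le_max_right _ _) hL)]⟩
  | mul_X p i hp =>
    obtain ⟨K1, h1'⟩ := hp
    have : ∃ K, ∀ L ≥ K, D L (MvPolynomial.X i) = E (MvPolynomial.X i) := by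
      match i with
      | none => exact h1
      | some 0 => exact h2
      | some (l+1) => exact h3 (l+1)
    obtain ⟨K2, h2⟩ := this
    exact ⟨max K1 K2, fun L hL => by
      rw [D_mul, D_mul, h1' L (le_trans (le_max_left _ _) hL), h2 L (le_trans (le_max_right _ _) hL)]⟩

lemma du_van (f : A) : ∃ K, ∀ L ≥ K, du L f = 0 := by
  have := stab du 0 ⟨1, fun L hL => ?_⟩ ⟨1, fun L hL => ?_⟩ (fun l => ⟨l+1, fun L hL => ?_⟩) f
  · simpa using this
  · rw [du_ell, if_neg (by omega)]; rfl
  · rw [du_xx, if_neg (by omega)]; rfl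
  · rw [du_xi, if_neg (by omega), if_neg (by omega)]; simp

lemma da_van (f : A) : ∃ K, ∀ L ≥ K, da L f = 0 := by
  have := stab da 0 ⟨2, fun L hL => ?_⟩ ⟨2, fun L hL => ?_⟩ (fun l => ⟨l+2, fun L hL => ?_⟩) f
  · simpa using this
  · obtain ⟨m, rfl⟩ := Nat.exists_eq_add_of_le hL
    rw [add_comm, da2_ell]; rfl
  · obtain ⟨m, rfl⟩ := Nat.exists_eq_add_of_le hL
    rw [add_comm, da2_xx]; rfl
  · obtain ⟨m, rfl⟩ := Nat.exists_eq_add_of_le hL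
    rw [show l + 2 + m = (l+m)+2 by omega, da2_xi, if_neg (by omega)]; rfl

/-! ### the series -/

def xis : A⟦X⟧ := PowerSeries.mk xi
def sinv : A⟦X⟧ := PowerSeries.invOfUnit xis 1
def etas : A⟦X⟧ := PowerSeries.mk (fun l => MvPolynomial.C (1/(2*(l:ℚ)+3)) * xi l)
def Tt : A⟦X⟧ := sinv * etas

lemma xis_sinv : xis * sinv = 1 := by
  apply PowerSeries.mul_invOfUnit
  simp [xis, ← coeff_zero_eq_constantCoeff_apply, xi]

lemma sinv_xis : sinv * xis = 1 := by rw [mul_comm, xis_sinv]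

lemma Tt_xis : Tt * xis = etas := by
  rw [Tt, mul_right_comm, sinv_xis, one_mul]

lemma coeff_X_pow_mul_if (f : A⟦X⟧) (N l : ℕ) :
    coeff l (X^N * f) = if N ≤ l then coeff (l-N) f else 0 := coeff_X_pow_mul' f N l

lemma coeff_X_mul_dX (f : A⟦X⟧) (l : ℕ) : coeff l (X * dX f) = (l:A) * coeff l f := by
  cases l with
  | zero => simp
  | succ l => rw [coeff_succ_X_mul, coeff_dX]; push_cast; ring

lemma cC (l : ℕ) : (2*(l:A)+3) * MvPolynomial.C (1/(2*(l:ℚ)+3)) = 1 := by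
  have : (2*(l:A)+3) = MvPolynomial.C (2*(l:ℚ)+3) := by
    rw [map_add, map_mul, map_natCast, map_ofNat, map_ofNat]
  rw [this, ← map_mul]
  have : (2*(l:ℚ)+3) ≠ 0 := by positivity
  field_simp
  simp

lemma cw_xis (N : ℕ) : cw (du N) xis =
    X^N * (2 * (X * dX xis) + (2*(N:A⟦X⟧)+3) * xis) - (if N = 0 then 3 * xis else 0) := by
  ext1 l
  have e1 : (2*(N:A⟦X⟧)+3) = C (2*(N:A)+3) := by simp [C_two, C_three]
  have e2 : (2:A⟦X⟧) = C (2:A) := C_two.symm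
  have e3 : (3:A⟦X⟧) = C (3:A) := C_three.symm
  rw [coeff_cw, map_sub, coeff_X_pow_mul_if, map_add, e1, coeff_C_mul, e2, coeff_C_mul, coeff_X_mul_dX,
    apply_ite (coeff l), e3, coeff_C_mul, map_zero]
  simp only [xis, coeff_mk]
  rw [du_xi]
  congr 1
  split_ifs with h
  · rw [Nat.cast_sub h]; ring
  · rfl

lemma dX_etas : 2 * (X * dX etas) = xis - 3 * etas := by
  ext1 l
  have e2 : (2:A⟦X⟧) = C (2:A) := C_two.symm
  have e3 : (3:A⟦X⟧) = C (3:A) := C_three.symm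
  rw [e2, coeff_C_mul, coeff_X_mul_dX, map_sub, e3, coeff_C_mul]
  simp only [etas, xis, coeff_mk]
  linear_combination (xi l) * cC l

lemma cw_etas (N : ℕ) : cw (du N) etas = X^N * xis - (if N = 0 then 3 * etas else 0) := by
  ext1 l
  have e3 : (3:A⟦X⟧) = C (3:A) := C_three.symm
  rw [coeff_cw, map_sub, coeff_X_pow_mul_if, apply_ite (coeff l), e3, coeff_C_mul, map_zero]
  simp only [xis, etas, coeff_mk]
  rw [← MvPolynomial.smul_eq_C_mul, Derivation.map_smul, du_xi, MvPolynomial.smul_eq_C_mul, MvPolynomial.smul_eq_C_mul, mul_sub]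
  split_ifs with h h2 h2
  · linear_combination (xi (l-N)) * cC l
  · linear_combination (xi (l-N)) * cC l
  · omega
  · ring

lemma cw_Tt (N : ℕ) : cw (du N) Tt = X^N * (2 * (X * dX Tt) - 2 * (N:A⟦X⟧) * Tt) := by
  have h1 := cw_etas N
  have h2 := dX_etas
  rw [← Tt_xis] at h1 h2
  rw [D_mul, cw_xis] at h1
  rw [D_mul] at h2
  have h3 : xis * cw (du N) Tt = xis * (X^N * (2 * (X * dX Tt) - 2 * (N:A⟦X⟧) * Tt)) := by
    split_ifs at h1
    · linear_combination h1 - X^N * h2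
    · linear_combination h1 - X^N * h2
  have h4 := congrArg (sinv * ·) h3
  simpa only [← mul_assoc, sinv_xis, one_mul] using h4

def tc (M : ℕ) : A := coeff M Tt
def sc (M : ℕ) : A := coeff M sinv

lemma du_tc (N M : ℕ) : du N (tc M) = if N ≤ M then 2 * ((M:A) - 2 * N) * tc (M - N) else 0 := by
  have h := congrArg (coeff M) (cw_Tt N)
  have e1 : 2 * (N:A⟦X⟧) = C (2*(N:A)) := by simp [C_two, C_three]
  have e2 : (2:A⟦X⟧) = C (2:A) := C_two.symm
  rw [coeff_cw, coeff_X_pow_mul_if, map_sub, e1, coeff_C_mul, e2, coeff_C_mul, coeff_X_mul_dX] at h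
  rw [tc, h]
  split_ifs with h
  · rw [Nat.cast_sub h, tc]; ring
  · rfl

lemma kill_tc (D : Derivation ℚ A A) (hD : ∀ l, D (xi l) = 0) (M : ℕ) : D (tc M) = 0 := by
  have h1 : cw D xis = 0 := by ext1 l; simp [xis, hD]
  have h2 : cw D etas = 0 := by
    ext1 l
    rw [coeff_cw, etas, coeff_mk, ← MvPolynomial.smul_eq_C_mul, Derivation.map_smul, hD]; simp
  rw [← Tt_xis, D_mul, h1, mul_zero, zero_add] at h2
  have h4 := congrArg (sinv * ·) h2
  simp only [← mul_assoc, sinv_xis, one_mul, mul_zero] at h4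
  rw [tc, ← coeff_cw, h4]; simp

lemma sc0 : sc 0 = 1 := by
  simp [sc, sinv]

lemma tc0 : 3 * tc 0 = 1 := by
  simp only [tc, Tt, coeff_zero_eq_constantCoeff_apply, map_mul]
  have h0 := sc0
  simp only [sc, coeff_zero_eq_constantCoeff_apply] at h0
  rw [h0, etas, ← coeff_zero_eq_constantCoeff_apply, coeff_mk]
  have := cC 0
  simpa using this

lemma sum_tc (l : ℕ) : (2*(l:A)+3) * ∑ M ∈ Finset.range (l+1), tc M * xi (l-M) = xi l := by
  have h := congrArg (coeff l) Tt_xis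
  rw [coeff_mul, Finset.Nat.sum_antidiagonal_eq_sum_range_succ_mk] at h
  simp only [xis, etas, coeff_mk] at h
  simp only [tc]
  rw [h]
  linear_combination (xi l) * cC l

lemma sum_sc (l : ℕ) : ∑ M ∈ Finset.range (l+1), sc M * xi (l-M) = if l = 0 then 1 else 0 := by
  have h := congrArg (coeff l) sinv_xis
  rw [coeff_mul, Finset.Nat.sum_antidiagonal_eq_sum_range_succ_mk, coeff_one] at h
  simpa only [xis, sc, coeff_mk] using h

lemma sc1 : sc 1 = - xi 1 := by
  have h := sum_sc 1
  simp [Finset.sum_range_succ, sc0] at h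
  linear_combination h

lemma sum_apply (s : Finset ℕ) (c : ℕ → A) (D : ℕ → Derivation ℚ A A) (f : A) :
    (∑ M ∈ s, c M • D M) f = ∑ M ∈ s, c M * D M f := by
  induction s using Finset.induction_on with
  | empty => simp
  | insert a s ha ih => rw [Finset.sum_insert ha, Finset.sum_insert ha, Derivation.add_apply, ih]; rfl

lemma sum_le_ite (L l : ℕ) (h : l + 1 ≤ L) (g : ℕ → A) :
    ∑ M ∈ Finset.range L, (if M ≤ l then g M else 0) = ∑ M ∈ Finset.range (l+1), g M := by
  rw [← Finset.sum_filter]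
  congr 1
  ext M; simp; omega

lemma Eul_sum (f : A) : ∃ K, ∀ L ≥ K, ∑ M ∈ Finset.range L, tc M * du M f = Eul f := by
  have := stab (fun L => ∑ M ∈ Finset.range L, tc M • du M) Eul ⟨1, fun L hL => ?_⟩
    ⟨1, fun L hL => ?_⟩ (fun l => ⟨l+1, fun L hL => ?_⟩) f
  · simpa only [sum_apply] using this
  · rw [sum_apply]
    obtain ⟨m, rfl⟩ := Nat.exists_eq_add_of_le' hL
    rw [Finset.sum_range_succ']
    simp only [du1_ell, du0_ell, mul_zero, Finset.sum_const_zero, Eul_ell]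
    linear_combination tc0
  · rw [sum_apply]
    obtain ⟨m, rfl⟩ := Nat.exists_eq_add_of_le' hL
    rw [Finset.sum_range_succ']
    simp only [du1_xx, du0_xx, mul_zero, Finset.sum_const_zero, Eul_xx]
    linear_combination -xx * tc0
  · rw [sum_apply]
    have h1 := sum_tc l
    simp only [du_xi, mul_sub, mul_ite, mul_zero, Finset.sum_sub_distrib]
    rw [sum_le_ite _ _ hL, Finset.sum_ite_eq' (Finset.range L) 0, if_pos (by simp; omega), Eul_xi]
    have h2 : ∑ M ∈ Finset.range (l+1), tc M * ((2*(l:A)+3) * xi (l-M)) =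
       (2*(l:A)+3) * ∑ M ∈ Finset.range (l+1), tc M * xi (l-M) := by
      rw [Finset.mul_sum]; apply Finset.sum_congr rfl; intros; ring
    rw [h2, h1]
    linear_combination - xi l * tc0

lemma da_sums (n : ℕ) (f : A) : ∃ K, ∀ L ≥ K,
    ∑ j ∈ Finset.range L, (xx * sc j) * du (n+j) f = da (n+1) f := by
  have := stab (fun L => ∑ j ∈ Finset.range L, (xx * sc j) • du (n+j)) (da (n+1)) ⟨1, fun L hL => ?_⟩
    ⟨1, fun L hL => ?_⟩ (fun l => ⟨l+1, fun L hL => ?_⟩) f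
  · obtain ⟨K, hK⟩ := this
    refine ⟨K, fun L hL => ?_⟩
    rw [← hK L hL]
    exact (sum_apply _ (fun j => xx * sc j) (fun j => du (n+j)) f).symm
  · rw [sum_apply _ (fun j => xx * sc j) (fun j => du (n+j))]
    obtain ⟨m, rfl⟩ := Nat.exists_eq_add_of_le' hL
    rw [Finset.sum_range_succ']
    simp only [← add_assoc, du1_ell, mul_zero, Finset.sum_const_zero, add_zero, du_ell, das_ell, sc0]
    split_ifs <;> ring
  · rw [sum_apply _ (fun j => xx * sc j) (fun j => du (n+j))]
    obtain ⟨m, rfl⟩ := Nat.exists_eq_add_of_le' hL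
    rw [Finset.sum_range_succ']
    simp only [← add_assoc, du1_xx, mul_zero, Finset.sum_const_zero, add_zero, du_xx, das_xx, sc0]
    split_ifs <;> ring
  · rw [sum_apply _ (fun j => xx * sc j) (fun j => du (n+j))]
    simp only [du_xi, mul_sub, mul_ite, mul_zero, Finset.sum_sub_distrib, das_xi]
    congr 1
    · by_cases h : n ≤ l
      · have e : ∀ j, (n + j ≤ l) ↔ j ≤ l - n := by intro j; omega
        have e2 : ∀ j, l - (n + j) = l - n - j := by intro j; omega
        simp only [e, e2]
        rw [sum_le_ite _ _ (by omega)]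
        have h1 := sum_sc (l-n)
        have h2 : ∑ M ∈ Finset.range (l-n+1), xx * sc M * ((2*(l:A)+3) * xi (l-n-M)) =
           xx * (2*(l:A)+3) * ∑ M ∈ Finset.range (l-n+1), sc M * xi (l-n-M) := by
          rw [Finset.mul_sum]; apply Finset.sum_congr rfl; intros; ring
        rw [h2, h1]
        have e3 : l - n = 0 ↔ l = n := by omega
        simp only [e3]
        split_ifs with h4
        · subst h4; ring
        · ring
      · rw [if_neg (by omega)]
        apply Finset.sum_eq_zero
        intro j _
        rw [if_neg (by omega)]
    · obtain ⟨m, rfl⟩ := Nat.exists_eq_add_of_le' (show 1 ≤ L by omega)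
      rw [Finset.sum_range_succ']
      simp only [← add_assoc, Nat.succ_ne_zero, if_false, Finset.sum_const_zero, sc0]
      split_ifs <;> first | omega | ring

lemma da_sum0 (f : A) : ∃ K, ∀ L ≥ K,
    ∑ j ∈ Finset.range L, (xx * sc (j+1)) * du j f = da 0 f := by
  have := stab (fun L => ∑ j ∈ Finset.range L, (xx * sc (j+1)) • du j) (da 0) ⟨1, fun L hL => ?_⟩
    ⟨1, fun L hL => ?_⟩ (fun l => ⟨l+1, fun L hL => ?_⟩) f
  · obtain ⟨K, hK⟩ := this
    refine ⟨K, fun L hL => ?_⟩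
    rw [← hK L hL]
    exact (sum_apply _ (fun j => xx * sc (j+1)) (fun j => du (j)) f).symm
  · rw [sum_apply _ (fun j => xx * sc (j+1)) (fun j => du (j))]
    obtain ⟨m, rfl⟩ := Nat.exists_eq_add_of_le' hL
    rw [Finset.sum_range_succ']
    simp only [du1_ell, mul_zero, Finset.sum_const_zero, add_zero, du0_ell, da0_ell, zero_add, sc1]
    ring
  · rw [sum_apply _ (fun j => xx * sc (j+1)) (fun j => du (j))]
    obtain ⟨m, rfl⟩ := Nat.exists_eq_add_of_le' hL
    rw [Finset.sum_range_succ']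
    simp only [du1_xx, mul_zero, Finset.sum_const_zero, add_zero, du0_xx, da0_xx, zero_add, sc1]
    ring
  · rw [sum_apply _ (fun j => xx * sc (j+1)) (fun j => du (j))]
    simp only [du_xi, mul_sub, mul_ite, mul_zero, Finset.sum_sub_distrib, da0_xi]
    rw [sum_le_ite _ _ hL, Finset.sum_ite_eq' (Finset.range L) 0, if_pos (by simp; omega)]
    have h1 := sum_sc (l+1)
    rw [Finset.sum_range_succ', if_neg (by omega), sc0] at h1
    have h2 : ∑ M ∈ Finset.range (l+1), xx * sc (M+1) * ((2*(l:A)+3) * xi (l-M)) =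
       xx * (2*(l:A)+3) * ∑ M ∈ Finset.range (l+1), sc (M+1) * xi (l+1-(M+1)) := by
      rw [Finset.mul_sum]; apply Finset.sum_congr rfl; intros
      rw [Nat.add_sub_add_right]; ring
    rw [h2, zero_add, sc1]
    simp only [Nat.sub_zero] at h1
    linear_combination xx * (2*(l:A)+3) * h1

end Aux9

end PE1nc

end PE1sec

section PE2sec


set_option linter.unusedSimpArgs false
set_option linter.unusedSectionVars false

noncomputable section PE2nc

namespace Aux9

open PowerSeries

lemma D_C (D : Derivation ℚ A A) (c : ℚ) : D (MvPolynomial.C c) = 0 := by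
  have : (MvPolynomial.C c : A) = algebraMap ℚ A c := rfl
  rw [this, Derivation.map_algebraMap]

lemma D_C_mul (D : Derivation ℚ A A) (c : ℚ) (f : A) :
    D (MvPolynomial.C c * f) = MvPolynomial.C c * D f := by
  rw [D_mul, D_C]; ring

/-- the explicit quadratic expression, at order `n+1` -/
def Ee (f : ℕ → A) (n M : ℕ) : A :=
  ∑ i ∈ Finset.range M, (∑ p ∈ Finset.HasAntidiagonal.antidiagonal (n+1), da i (f p.1) * da (M-1-i) (f p.2)
    + VA.W (f n) i (M-1-i))

lemma lift_W (F : A⟦X⟧) (i j n : ℕ) : coeff n (VA.lift.W F i j) = VA.W (coeff n F) i j := by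
  match i, j with
  | 0, 0 => simp [VD.W, VD.lift, VA]
  | 0, (j+1) => simp [VD.W, VD.lift, VA]
  | (i+1), j => simp [VD.W, VD.lift, VA]

lemma coeff_e (f : ℕ → A) (n M : ℕ) :
    coeff (n+1) (VA.lift.e (PowerSeries.mk f) X M) = Ee f n M := by
  rw [VD.e, map_sum, Ee]
  apply Finset.sum_congr rfl
  intro i _
  rw [map_add, coeff_succ_X_mul, lift_W, coeff_mk, coeff_mul]
  congr 1
  apply Finset.sum_congr rfl
  intro p _
  simp [VD.lift, VA]

lemma coeff0_e (f : ℕ → A) (M : ℕ) (h0 : f 0 = 0) :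
    coeff 0 (VA.lift.e (PowerSeries.mk f) X M) = 0 := by
  rw [VD.e, map_sum]
  apply Finset.sum_eq_zero
  intro i _
  rw [map_add, coeff_zero_X_mul, coeff_mul]
  simp [VD.lift, VA, h0]

lemma W_zero (i j : ℕ) : VA.W 0 i j = 0 := by
  match i, j with
  | 0, 0 => simp [VD.W, VA]
  | 0, (j+1) => simp [VD.W, VA]
  | (i+1), j => simp [VD.W, VA]

structure Good (G : ℕ) (f : ℕ → A) : Prop where
  f0 : f 0 = 0
  f1 : f 1 = MvPolynomial.C (-1/24) * ell
  hu : ∀ n, 1 ≤ n → n + 1 ≤ G → ∀ N, 2 * du N (f (n+1)) = - Ee f n N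
  hE : ∀ h, ∃ c : ℚ, Eul (f h) = (2 - 2 * (h:A)) * f h + MvPolynomial.C c
  hl : ∀ h, ∃ c : ℚ, dell (f h) = MvPolynomial.C c
  hE' : ∀ h, 2 ≤ h → Eul (f h) = (2 - 2 * (h:A)) * f h
  hl' : ∀ h, 2 ≤ h → dell (f h) = 0

lemma W_van (f : A) (K : ℕ) (hK : ∀ L ≥ K, da L f = 0) (i j : ℕ) (h : K + 1 ≤ i ∨ K + 1 ≤ j) :
    VA.W f i j = 0 := by
  match i, j with
  | 0, 0 => omega
  | 0, (j+1) =>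
    change da (j+1) (da 0 f) = 0
    rw [da_a0, hK (j+1) (by omega), hK j (by omega)]; simp
  | (i+1), 0 =>
    change da (i+1) (da 0 f) = 0
    rw [da_a0, hK (i+1) (by omega), hK i (by omega)]; simp
  | (i+1), (j+1) =>
    change da (i+1) (da (j+1) f) = 0
    rcases h with h | h
    · rw [da_aa, hK (i+1) (by omega), map_zero]
    · rw [hK (j+1) (by omega), map_zero]

lemma unif_van (f : ℕ → A) (n : ℕ) : ∃ K, ∀ h ≤ n, ∀ L ≥ K, da L (f h) = 0 := by
  induction n with
  | zero =>
    obtain ⟨K, hK⟩ := da_van (f 0)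
    exact ⟨K, fun h hh => by
      have : h = 0 := by omega
      subst this; exact hK⟩
  | succ n ih =>
    obtain ⟨K, hK⟩ := ih
    obtain ⟨K', hK'⟩ := da_van (f (n+1))
    refine ⟨max K K', fun h hh L hL => ?_⟩
    rcases Nat.lt_or_ge n h with h1 | h1
    · have : h = n + 1 := by omega
      subst this
      exact hK' L (le_trans (le_max_right _ _) hL)
    · exact hK h h1 L (le_trans (le_max_left _ _) hL)

lemma Ee_van (f : ℕ → A) (n : ℕ) : ∃ K, ∀ M ≥ K, Ee f n M = 0 := by
  obtain ⟨K, hK⟩ := unif_van f (n+1)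
  refine ⟨2*K+4, fun M hM => ?_⟩
  rw [Ee]
  apply Finset.sum_eq_zero
  intro i hi
  rw [Finset.mem_range] at hi
  rw [W_van (f n) K (hK n (by omega)) i _ (by omega), add_zero]
  apply Finset.sum_eq_zero
  intro p hp
  rw [Finset.HasAntidiagonal.mem_antidiagonal] at hp
  rcases Nat.lt_or_ge i K with h | h
  · rw [hK p.2 (by omega) (M-1-i) (by omega), mul_zero]
  · rw [hK p.1 (by omega) i h, zero_mul]

lemma Eul_daf {G : ℕ} {f : ℕ → A} (hf : Good G f) (i h : ℕ) :
    Eul (da i (f h)) = (1 - 2 * (h:A)) * da i (f h) := by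
  obtain ⟨c, hc⟩ := hf.hE h
  rw [Eul_da, hc, map_add, D_C, D_mul, map_sub, D_mul, D_2, Derivation.map_natCast]
  ring

lemma Eul_W {G : ℕ} {f : ℕ → A} (hf : Good G f) (i j h : ℕ) :
    Eul (VA.W (f h) i j) = (- 2 * (h:A)) * VA.W (f h) i j := by
  have key : ∀ i j, Eul (da i (da j (f h))) = (- 2 * (h:A)) * da i (da j (f h)) := by
    intro i j
    rw [Eul_da, Eul_daf hf, D_mul, map_sub, D_mul, D_2, Derivation.map_natCast,
      Derivation.map_one_eq_zero]
    ring
  match i, j with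
  | 0, 0 => exact key 0 0
  | 0, (j+1) => exact key (j+1) 0
  | (i+1), j => exact key (i+1) j

lemma dell_daf {G : ℕ} {f : ℕ → A} (hf : Good G f) (i h : ℕ) : dell (da i (f h)) = 0 := by
  obtain ⟨c, hc⟩ := hf.hl h
  rw [dell_da, hc, D_C]

lemma dell_W {G : ℕ} {f : ℕ → A} (hf : Good G f) (i j h : ℕ) : dell (VA.W (f h) i j) = 0 := by
  have key : ∀ i j, dell (da i (da j (f h))) = 0 := by
    intro i j
    rw [dell_da, dell_daf hf, map_zero]
  match i, j with
  | 0, 0 => exact key 0 0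
  | 0, (j+1) => exact key (j+1) 0
  | (i+1), j => exact key (i+1) j

lemma Eul_Ee {G : ℕ} {f : ℕ → A} (hf : Good G f) (n M : ℕ) :
    Eul (Ee f n M) = (- 2 * (n:A)) * Ee f n M := by
  rw [Ee, map_sum, Finset.mul_sum]
  apply Finset.sum_congr rfl
  intro i _
  rw [map_add, Eul_W hf, map_sum, mul_add, Finset.mul_sum]
  congr 1
  apply Finset.sum_congr rfl
  intro p hp
  rw [Finset.HasAntidiagonal.mem_antidiagonal] at hp
  have hp' : (p.1 : A) + p.2 = n + 1 := by exact_mod_cast hp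
  rw [D_mul, Eul_daf hf, Eul_daf hf]
  linear_combination (-2 * da i (f p.1) * da (M-1-i) (f p.2)) * hp'

lemma dell_Ee {G : ℕ} {f : ℕ → A} (hf : Good G f) (n M : ℕ) : dell (Ee f n M) = 0 := by
  rw [Ee, map_sum]
  apply Finset.sum_eq_zero
  intro i _
  rw [map_add, dell_W hf, map_sum, add_zero]
  apply Finset.sum_eq_zero
  intro p hp
  rw [D_mul, dell_daf hf, dell_daf hf]
  ring

lemma Ee_closed {n : ℕ} (hn : 1 ≤ n) {f : ℕ → A} (hf : Good n f) (N M : ℕ) :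
    du N (Ee f n M) - du M (Ee f n N) = 2 * ((N:A) - M) * Ee f n (N+M) := by
  have h := VA.lift.closed (PowerSeries.mk f) X (fun i => by simp [VD.lift]) (fun i => by simp [VD.lift])
    (Ideal.span {X^(n+1)}) (Ideal.span {X^(n+2)}) ?_ ?_ ?_ ?_ N M
  · rw [Ideal.mem_span_singleton, X_pow_dvd_iff] at h
    have h1 := h (n+1) (by omega)
    have e1 : 2 * ((N:A⟦X⟧) - M) = C (2*((N:A)-M)) := by simp [C_two, C_three]
    have e8 : (8:A⟦X⟧) = C (8:A) := (map_ofNat C 8).symm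
    rw [e8, coeff_C_mul, map_sub, map_sub, e1, coeff_C_mul] at h1
    simp only [VD.lift] at h1
    change 8 * (coeff (n+1) (cw (du N) (VA.lift.e (mk f) X M)) - coeff (n+1) (cw (du M) (VA.lift.e (mk f) X N)) - 2*((N:A)-M) * coeff (n+1) (VA.lift.e (mk f) X (N+M))) = 0 at h1
    rw [coeff_cw, coeff_cw, coeff_e, coeff_e, coeff_e] at h1
    have h2 := (mul_eq_zero.mp h1).resolve_left (by norm_num)
    linear_combination h2
  · intro i p hp
    rw [Ideal.mem_span_singleton, X_pow_dvd_iff] at hp ⊢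
    intro m hm
    simp [VD.lift, hp m hm]
  · intro i p hp
    rw [Ideal.mem_span_singleton] at hp ⊢
    rw [pow_succ']
    apply mul_dvd_mul _ hp
    rw [X_dvd_iff, ← coeff_zero_eq_constantCoeff_apply]
    simp [VD.lift, hf.f0]
  · intro p hp
    rw [Ideal.mem_span_singleton] at hp ⊢
    rw [pow_succ']
    exact mul_dvd_mul dvd_rfl hp
  · intro N
    rw [Ideal.mem_span_singleton, X_pow_dvd_iff]
    intro m hm
    have e4 : (4:A⟦X⟧) = C (4:A) := (map_ofNat C 4).symm
    have e8 : (8:A⟦X⟧) = C (8:A) := (map_ofNat C 8).symm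
    rw [e8, e4, map_add, map_add, coeff_C_mul, coeff_C_mul]
    change 8 * coeff m (cw (du N) (mk f)) + _ + _ = 0
    rw [coeff_cw, coeff_mk]
    match m, hm with
    | 0, _ =>
      rw [coeff0_e f N hf.f0, hf.f0]
      split_ifs <;> simp
    | 1, _ =>
      rw [coeff_e f 0 N, hf.f1, D_C_mul, du_ell]
      have : Ee f 0 N = 0 := by
        rw [Ee]
        apply Finset.sum_eq_zero
        intro i _
        rw [hf.f0, W_zero]
        simp [Finset.Nat.antidiagonal_succ, hf.f0]
      rw [this]
      split_ifs
      · simp only [coeff_X, if_true]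
        have : (8:A) * (MvPolynomial.C (-1/24) * 3) = -1 := by
          have h3 : (3:A) = MvPolynomial.C 3 := (map_ofNat MvPolynomial.C 3).symm
          have h8 : (8:A) = MvPolynomial.C 8 := (map_ofNat MvPolynomial.C 8).symm
          rw [h3, h8, ← map_mul, ← map_mul]
          norm_num
        rw [this]; simp
      · simp
    | (k+2), hm =>
      have := hf.hu (k+1) (by omega) (by omega) N
      rw [show k+2 = (k+1)+1 from rfl, coeff_e]
      have h0 : coeff (k+1+1) (if N = 0 then (X : A⟦X⟧) else 0) = 0 := by
        split_ifs
        · rw [coeff_X, if_neg (by omega)]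
        · simp
      rw [h0]
      linear_combination 4 * this

lemma sum_ext_zero (r : ℕ → A) (K L : ℕ) (hL : K ≤ L) (hr : ∀ M ≥ K, r M = 0) :
    ∑ M ∈ Finset.range L, tc M * r M = ∑ M ∈ Finset.range K, tc M * r M := by
  symm
  apply Finset.sum_subset (Finset.range_subset_range.mpr hL)
  intro M _ h2
  rw [hr M (by simpa using h2), mul_zero]

lemma integrate (r : ℕ → A) (n : ℕ) (K : ℕ) (hr : ∀ M ≥ K, r M = 0)
    (hE : ∀ N, Eul (r N) = (-2 * (n:A)) * r N)
    (hc : ∀ N M, du N (r M) - du M (r N) = 2 * ((N:A) - M) * r (N+M)) (N : ℕ) :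
    du N (∑ M ∈ Finset.range K, tc M * r M) = (-2 * (n:A)) * r N := by
  obtain ⟨K2, hK2⟩ := Eul_sum (r N)
  set L := K + K2 with hL
  rw [← sum_ext_zero r K (N+L) (by omega) hr, map_sum, ← hE, ← hK2 (N+L) (by omega)]
  have e1 : ∀ M, du N (tc M * r M) = tc M * du M (r N) + tc M * (2 * ((N:A) - M) * r (N+M))
      + r M * du N (tc M) := by
    intro M
    rw [D_mul]
    linear_combination tc M * hc N M
  simp only [e1]
  rw [Finset.sum_add_distrib, Finset.sum_add_distrib, add_assoc]
  convert add_zero _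
  have e2 : ∑ M ∈ Finset.range (N+L), tc M * (2 * ((N:A) - M) * r (N+M))
      = ∑ M ∈ Finset.range L, tc M * (2 * ((N:A) - M) * r (N+M)) := by
    symm
    apply Finset.sum_subset (Finset.range_subset_range.mpr (by omega))
    intro M _ h2
    rw [Finset.mem_range] at h2
    rw [hr (N+M) (by omega)]; ring
  rw [e2, Finset.sum_range_add (fun M => r M * du N (tc M)) N L]
  have e3 : ∑ M ∈ Finset.range N, r M * du N (tc M) = 0 := by
    apply Finset.sum_eq_zero
    intro M hM
    rw [Finset.mem_range] at hM
    rw [du_tc, if_neg (by omega), mul_zero]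
  rw [e3, zero_add, ← Finset.sum_add_distrib]
  apply Finset.sum_eq_zero
  intro M _
  rw [du_tc, if_pos (by omega), Nat.add_sub_cancel_left]
  push_cast
  ring

lemma Ee_congr (f f' : ℕ → A) (n M : ℕ) (h0 : f 0 = 0) (h0' : f' 0 = 0) (h : ∀ k ≤ n, f k = f' k) :
    Ee f n M = Ee f' n M := by
  rw [Ee, Ee]
  apply Finset.sum_congr rfl
  intro i _
  rw [h n le_rfl]
  congr 1
  apply Finset.sum_congr rfl
  intro p hp
  rw [Finset.HasAntidiagonal.mem_antidiagonal] at hp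
  by_cases h1 : p.1 = 0
  · rw [h1, h0, h0']; simp
  by_cases h2 : p.2 = 0
  · rw [h2, h0, h0']; simp
  rw [h p.1 (by omega), h p.2 (by omega)]

lemma Good_one : Good 1 (Function.update 0 1 (MvPolynomial.C (-1/24) * ell)) where
  f0 := by simp
  f1 := by simp
  hu n h1 h2 := by omega
  hE h := by
    by_cases h1 : h = 1
    · subst h1
      refine ⟨-1/24, ?_⟩
      rw [Function.update_self, D_C_mul, Eul_ell]
      push_cast; ring
    · exact ⟨0, by simp [Function.update_of_ne h1]⟩
  hl h := by
    by_cases h1 : h = 1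
    · subst h1
      refine ⟨-1/24, ?_⟩
      rw [Function.update_self, D_C_mul, dell_ell]
      ring
    · exact ⟨0, by simp [Function.update_of_ne h1]⟩
  hE' h hh := by
    have h1 : h ≠ 1 := by omega
    simp [Function.update_of_ne h1]
  hl' h hh := by
    have h1 : h ≠ 1 := by omega
    simp [Function.update_of_ne h1]

lemma Good_succ {n : ℕ} (hn : 1 ≤ n) {f : ℕ → A} (hf : Good n f) : ∃ f', Good (n+1) f' := by
  obtain ⟨K, hK⟩ := Ee_van f n
  have hI := integrate (Ee f n) n K hK (Eul_Ee hf n) (Ee_closed hn hf)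
  set Q := ∑ M ∈ Finset.range K, tc M * Ee f n M with hQ
  have hEQ : Eul Q = (-2 * (n:A)) * Q := by
    rw [hQ, map_sum, Finset.mul_sum]
    apply Finset.sum_congr rfl
    intro M _
    rw [D_mul, Eul_Ee hf, kill_tc Eul Eul_xi]; ring
  have hlQ : dell Q = 0 := by
    rw [hQ, map_sum]
    apply Finset.sum_eq_zero
    intro M _
    rw [D_mul, dell_Ee hf, kill_tc dell dell_xi]; ring
  set q := MvPolynomial.C (1/(4*(n:ℚ))) * Q with hq
  have hc : (4 * (n:A)) * MvPolynomial.C (1/(4*(n:ℚ))) = 1 := by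
    have : (4 * (n:A)) = MvPolynomial.C (4 * (n:ℚ)) := by
      rw [map_mul, map_natCast, map_ofNat]
    rw [this, ← map_mul]
    have : (n:ℚ) ≠ 0 := by positivity
    field_simp
    simp
  have hEq : Eul q = (2 - 2 * ((n+1:ℕ):A)) * q := by
    rw [hq, D_C_mul, hEQ]; push_cast; ring
  have hlq : dell q = 0 := by rw [hq, D_C_mul, hlQ, mul_zero]
  refine ⟨Function.update f (n+1) q, ?_, ?_, ?_, ?_, ?_, ?_, ?_⟩
  · rw [Function.update_of_ne (by omega), hf.f0]
  · rw [Function.update_of_ne (by omega), hf.f1]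
  · intro k h1 h2 N
    rw [← Ee_congr f _ k N hf.f0 (by rw [Function.update_of_ne (by omega), hf.f0])
      (fun j hj => by rw [Function.update_of_ne (by omega)])]
    by_cases hk : k = n
    · subst hk
      rw [Function.update_self, hq, D_C_mul, hI]
      linear_combination (-Ee f k N) * hc
    · rw [Function.update_of_ne (by omega)]
      exact hf.hu k h1 (by omega) N
  · intro h
    by_cases hh : h = n+1
    · subst hh
      rw [Function.update_self]
      exact ⟨0, by rw [hEq]; simp⟩
    · rw [Function.update_of_ne hh]; exact hf.hE h
  · intro h
    by_cases hh : h = n+1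
    · subst hh
      rw [Function.update_self]
      exact ⟨0, by rw [hlq]; simp⟩
    · rw [Function.update_of_ne hh]; exact hf.hl h
  · intro h h2
    by_cases hh : h = n+1
    · subst hh
      rw [Function.update_self]
      exact hEq
    · rw [Function.update_of_ne hh]; exact hf.hE' h h2
  · intro h h2
    by_cases hh : h = n+1
    · subst hh
      rw [Function.update_self]
      exact hlq
    · rw [Function.update_of_ne hh]; exact hf.hl' h h2

theorem exists_Good (n : ℕ) : ∃ f, Good (n+1) f := by
  induction n with
  | zero => exact ⟨_, Good_one⟩
  | succ n ih =>
    obtain ⟨f, hf⟩ := ih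
    exact Good_succ (by omega) hf

end Aux9

end PE2nc

end PE2sec

section PFsec


set_option linter.unusedSimpArgs false
set_option linter.unusedSectionVars false

noncomputable section PFnc

namespace Aux9

open PowerSeries

def Yser (ρ : ℕ → ℝ) : ℝ⟦X⟧ := PowerSeries.mk (fun l => if l = 0 then 0 else ρ l / ρ 0)

def Ytr (ρ : ℕ → ℝ) (m : ℕ) : ℝ⟦X⟧ := ∑ a : Fin m, C (ρ ((a:ℕ)+1) / ρ 0) * X^((a:ℕ)+1)

lemma Y_sub (ρ : ℕ → ℝ) (m : ℕ) : X^(m+1) ∣ Yser ρ - Ytr ρ m := by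
  rw [X_pow_dvd_iff]
  intro k hk
  rw [map_sub, Yser, coeff_mk, Ytr, map_sum]
  simp only [coeff_C_mul, coeff_X_pow, mul_ite, mul_one, mul_zero]
  rcases k with _ | k
  · simp
  · rw [if_neg (by omega), Finset.sum_eq_single (⟨k, by omega⟩ : Fin m)]
    · simp
    · intro b _ hb
      rw [if_neg]
      intro h
      apply hb
      ext; simp; omega
    · simp

lemma coeff_Y_pow (ρ : ℕ → ℝ) (m i : ℕ) : coeff m (Yser ρ ^ i) = coeff m (Ytr ρ m ^ i) := by
  have h1 : X^(m+1) ∣ Yser ρ ^ i - Ytr ρ m ^ i := (Y_sub ρ m).trans (sub_dvd_pow_sub_pow _ _ _)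
  rw [X_pow_dvd_iff] at h1
  have := h1 m (by omega)
  rw [map_sub] at this
  linarith

lemma coeff_Ytr_pow (ρ : ℕ → ℝ) (m i : ℕ) : coeff m (Ytr ρ m ^ i) =
    ∑ k ∈ Finset.piAntidiag (Finset.univ : Finset (Fin m)) i,
      if (∑ a : Fin m, ((a:ℕ)+1) * k a) = m then
        (Nat.multinomial Finset.univ k : ℝ) * ∏ a : Fin m, (ρ ((a:ℕ)+1) / ρ 0) ^ (k a) else 0 := by
  rw [Ytr, Finset.sum_pow_eq_sum_piAntidiag, map_sum]
  apply Finset.sum_congr rfl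
  intro k _
  have e1 : ∏ a : Fin m, (C (ρ ((a:ℕ)+1) / ρ 0) * X^((a:ℕ)+1) : ℝ⟦X⟧) ^ k a =
      C (∏ a : Fin m, (ρ ((a:ℕ)+1) / ρ 0) ^ (k a)) * X ^ (∑ a : Fin m, ((a:ℕ)+1) * k a) := by
    simp only [mul_pow, Finset.prod_mul_distrib, map_prod, map_pow, ← pow_mul]
    rw [Finset.prod_pow_eq_pow_sum]
  have e2 : ((Nat.multinomial Finset.univ k : ℕ) : ℝ⟦X⟧) = C (Nat.multinomial Finset.univ k : ℝ) := by simp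
  rw [e1, e2, coeff_C_mul, coeff_C_mul, coeff_X_pow]
  simp only [mul_ite, mul_one, mul_zero, eq_comm]

lemma bell_coeff (ρ : ℕ → ℝ) (m i : ℕ) :
    (i.factorial : ℝ) * ((ρ 0)⁻¹) ^ i * NCQFT.bellP m i (fun j => (j.factorial : ℝ) * ρ j) / m.factorial
      = coeff m (Yser ρ ^ i) := by
  rw [coeff_Y_pow, coeff_Ytr_pow, NCQFT.bellP, ← Finset.sum_filter, ← Finset.sum_filter,
    Finset.mul_sum, Finset.sum_div]
  refine Finset.sum_bij' (fun j _ => fun a => (j a : ℕ))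
    (fun k _ => fun a => if h : k a < m + 1 then (⟨k a, h⟩ : Fin (m+1)) else 0) ?_ ?_ ?_ ?_ ?_
  · intro j hj
    rw [Finset.mem_filter] at hj
    rw [Finset.mem_filter, Finset.mem_piAntidiag]
    exact ⟨⟨hj.2.1, fun _ _ => Finset.mem_univ _⟩, hj.2.2⟩
  · intro k hk
    rw [Finset.mem_filter, Finset.mem_piAntidiag] at hk
    have hlt : ∀ a, k a < m + 1 := by
      intro a
      have h1 : ((a:ℕ)+1) * k a ≤ ∑ a : Fin m, ((a:ℕ)+1) * k a :=
        Finset.single_le_sum (f := fun a : Fin m => ((a:ℕ)+1) * k a) (fun _ _ => Nat.zero_le _) (Finset.mem_univ a)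
      nlinarith [hk.2]
    rw [Finset.mem_filter]
    refine ⟨Finset.mem_univ _, ?_, ?_⟩
    · simp only [hlt, dite_true]; exact hk.1.1
    · simp only [hlt, dite_true]; exact hk.2
  · intro j hj
    funext a
    simp only [(j a).isLt, dite_true]
  · intro k hk
    rw [Finset.mem_filter, Finset.mem_piAntidiag] at hk
    funext a
    have h1 : ((a:ℕ)+1) * k a ≤ ∑ a : Fin m, ((a:ℕ)+1) * k a :=
        Finset.single_le_sum (f := fun a : Fin m => ((a:ℕ)+1) * k a) (fun _ _ => Nat.zero_le _) (Finset.mem_univ a)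
    have : k a < m + 1 := by nlinarith [hk.2]
    simp [this]
  · intro j hj
    rw [Finset.mem_filter] at hj
    obtain ⟨_, hj1, hj2⟩ := hj
    have hm := Nat.multinomial_spec (Finset.univ : Finset (Fin m)) (fun a => (j a : ℕ))
    rw [hj1] at hm
    have hm' : (∏ a : Fin m, ((j a : ℕ).factorial : ℝ)) * (Nat.multinomial Finset.univ (fun a => (j a : ℕ)) : ℝ)
        = i.factorial := by exact_mod_cast hm
    have e0 : ∏ a : Fin m, (((((a:ℕ)+1).factorial : ℝ) * ρ ((a:ℕ)+1)) / (((a : ℕ) + 1).factorial : ℝ)) ^ (j a : ℕ)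
        = ∏ a : Fin m, (ρ ((a:ℕ)+1)) ^ (j a : ℕ) := by
      apply Finset.prod_congr rfl
      intro a _
      rw [mul_div_cancel_left₀ _ (by positivity)]
    have e1 : ∏ a : Fin m, (ρ ((a:ℕ)+1) / ρ 0) ^ (j a : ℕ) =
        (∏ a : Fin m, (ρ ((a:ℕ)+1)) ^ (j a : ℕ)) * ((ρ 0)⁻¹)^i := by
      rw [← hj1, ← Finset.prod_pow_eq_pow_sum, ← Finset.prod_mul_distrib]
      simp only [div_eq_mul_inv, mul_pow]
    rw [e0, e1, ← hm']
    have p1 : (∏ a : Fin m, ((j a : ℕ).factorial : ℝ)) ≠ 0 := Finset.prod_ne_zero_iff.mpr (fun a _ => by positivity)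
    have p2 : (m.factorial : ℝ) ≠ 0 := by positivity
    field_simp

lemma Sm_coeff (ρ : ℕ → ℝ) (m L : ℕ) (hL : m + 1 ≤ L) :
    NCQFT.Sm ρ m / m.factorial = coeff m (∑ i ∈ Finset.range L, (-Yser ρ)^i) := by
  have hz : ∀ i, m < i → coeff m ((-Yser ρ)^i) = 0 := by
    intro i hi
    have h : X^i ∣ (-Yser ρ)^i := by
      apply pow_dvd_pow_of_dvd
      rw [X_dvd_iff, ← coeff_zero_eq_constantCoeff_apply]
      simp [Yser]
    exact X_pow_dvd_iff.mp h m hi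
  rw [map_sum, ← Finset.sum_subset (Finset.range_subset_range.mpr hL)
    (fun i _ h2 => hz i (by simpa using h2)), NCQFT.Sm, Finset.sum_div]
  apply Finset.sum_congr rfl
  intro i _
  have : (-Yser ρ)^i = C ((-1:ℝ)^i) * Yser ρ ^ i := by
    rw [neg_pow]; simp
  rw [this, coeff_C_mul, ← bell_coeff]
  ring

lemma Sm_sum (ρ : ℕ → ℝ) (h0 : ρ 0 ≠ 0) (l : ℕ) :
    ∑ M ∈ Finset.range (l+1), NCQFT.Sm ρ M / M.factorial * (ρ (l-M) / ρ 0) = if l = 0 then 1 else 0 := by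
  have h1 : ∀ M ∈ Finset.range (l+1), NCQFT.Sm ρ M / M.factorial * (ρ (l-M) / ρ 0) =
      coeff M (∑ i ∈ Finset.range (l+1), (-Yser ρ)^i) * coeff (l-M) (1 + Yser ρ) := by
    intro M hM
    rw [Finset.mem_range] at hM
    rw [Sm_coeff ρ M (l+1) (by omega), map_add, coeff_one, Yser, coeff_mk]
    by_cases h : l - M = 0
    · rw [h]; simp [div_self h0]
    · rw [if_neg h, if_neg h, zero_add]
  rw [Finset.sum_congr rfl h1, ← Finset.Nat.sum_antidiagonal_eq_sum_range_succ_mk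
    (fun p => coeff p.1 (∑ i ∈ Finset.range (l+1), (-Yser ρ)^i) * coeff p.2 (1 + Yser ρ)), ← coeff_mul]
  have h2 : (∑ i ∈ Finset.range (l+1), (-Yser ρ)^i) * (1 + Yser ρ) = 1 - (-Yser ρ)^(l+1) := by
    have := geom_sum_mul_neg (-Yser ρ) (l+1)
    rwa [sub_neg_eq_add] at this
  rw [h2, map_sub, coeff_one]
  have h : X^(l+1) ∣ (-Yser ρ)^(l+1) := by
    apply pow_dvd_pow_of_dvd
    rw [X_dvd_iff, ← coeff_zero_eq_constantCoeff_apply]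
    simp [Yser]
  rw [X_pow_dvd_iff.mp h l (by omega), sub_zero]

/-! ### evaluation -/

def evf (ρ : ℕ → ℝ) : Option ℕ → ℝ
  | none => Real.log (ρ 0)
  | some 0 => (ρ 0)⁻¹
  | some (l+1) => ρ (l+1) / ρ 0

def ev (ρ : ℕ → ℝ) : A →ₐ[ℚ] ℝ := MvPolynomial.aeval (evf ρ)

lemma ev_ell (ρ : ℕ → ℝ) : ev ρ ell = Real.log (ρ 0) := by simp [ev, ell, evf]
lemma ev_xx (ρ : ℕ → ℝ) : ev ρ xx = (ρ 0)⁻¹ := by simp [ev, xx, evf]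
lemma ev_xi (ρ : ℕ → ℝ) (h0 : ρ 0 ≠ 0) (l : ℕ) : ev ρ (xi l) = ρ l / ρ 0 := by
  cases l with
  | zero => simp [div_self h0]
  | succ l => simp [ev, xi, evf]
lemma ev_C (ρ : ℕ → ℝ) (c : ℚ) : ev ρ (MvPolynomial.C c) = c := by simp [ev]

lemma ev_sc (ρ : ℕ → ℝ) (h0 : ρ 0 ≠ 0) (j : ℕ) : ev ρ (sc j) = NCQFT.Sm ρ j / j.factorial := by
  induction j using Nat.strong_induction_on with
  | _ j ih =>
    have h1 := congrArg (ev ρ) (sum_sc j)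
    have h2 := Sm_sum ρ h0 j
    rw [map_sum] at h1
    simp only [map_mul, ev_xi ρ h0] at h1
    rw [Finset.sum_range_succ] at h1 h2
    rw [Finset.sum_congr rfl (fun M hM => by rw [ih M (Finset.mem_range.mp hM)])] at h1
    rw [apply_ite (ev ρ), map_one, map_zero] at h1
    simp only [Nat.sub_self, div_self h0, mul_one] at h1 h2
    linarith

/-! ### formula for the coefficients -/

def Eb (f : ℕ → A) (n : ℕ) : ℕ → A
  | 0 => 0
  | (m+1) => Ee f n m

lemma two_C : (2:A) * MvPolynomial.C (1/2) = 1 := by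
  have h2 : (2:A) = MvPolynomial.C 2 := (map_ofNat MvPolynomial.C 2).symm
  rw [h2, ← map_mul]; norm_num

lemma da_form {G : ℕ} {f : ℕ → A} (hf : Good G f) (n : ℕ) (h1 : 1 ≤ n) (h2 : n + 1 ≤ G) (k : ℕ) :
    ∃ K, ∀ L ≥ K, 2 * da k (f (n+1)) = - (xx * ∑ j ∈ Finset.range L, Eb f n (k+j) * sc j) := by
  cases k with
  | zero =>
    obtain ⟨K, hK⟩ := da_sum0 (f (n+1))
    refine ⟨K+1, fun L hL => ?_⟩
    obtain ⟨L', rfl⟩ := Nat.exists_eq_add_of_le' (show 1 ≤ L by omega)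
    rw [← hK L' (by omega), Finset.sum_range_succ', Finset.mul_sum]
    simp only [zero_add]
    simp only [Eb, zero_mul, add_zero]
    rw [Finset.mul_sum, ← Finset.sum_neg_distrib]
    apply Finset.sum_congr rfl
    intro j _
    linear_combination xx * sc (j+1) * hf.hu n h1 h2 j
  | succ k =>
    obtain ⟨K, hK⟩ := da_sums k (f (n+1))
    refine ⟨K, fun L hL => ?_⟩
    rw [← hK L hL, Finset.mul_sum, Finset.mul_sum, ← Finset.sum_neg_distrib]
    apply Finset.sum_congr rfl
    intro j _
    rw [show k + 1 + j = (k+j)+1 by omega, Eb]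
    linear_combination xx * sc j * hf.hu n h1 h2 (k+j)

lemma Eb_van (f : ℕ → A) (n : ℕ) : ∃ K, ∀ M ≥ K, Eb f n M = 0 := by
  obtain ⟨K, hK⟩ := Ee_van f n
  refine ⟨K+1, fun M hM => ?_⟩
  obtain ⟨L', rfl⟩ := Nat.exists_eq_add_of_le' (show 1 ≤ M by omega)
  exact hK L' (by omega)

end Aux9

end PFnc

end PFsec

section PGsec


set_option linter.unusedSimpArgs false
set_option linter.unusedSectionVars false

noncomputable section PGnc

namespace Aux9

open NCQFT

lemma evf_deriv (ρ : ℕ → ℝ) (h0 : ρ 0 ≠ 0) (l : ℕ) (o : Option ℕ) :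
    HasDerivAt (fun t => ev (Function.update ρ l t) (MvPolynomial.X o))
      (ev ρ (da (l+1) (MvPolynomial.X o)) / (2*(l:ℝ)+3)) (ρ l) := by
  match o with
  | none =>
    change HasDerivAt (fun t => ev (Function.update ρ l t) ell) (ev ρ (da (l+1) ell) / _) _
    simp only [ev_ell, das_ell]
    cases l with
    | zero =>
      have := Real.hasDerivAt_log h0
      simp only [Function.update_self, if_true, map_mul, ev_xx, map_ofNat]
      refine HasDerivAt.congr_deriv this ?_
      norm_num
    | succ l =>
      simp only [Function.update_of_ne (show (0:ℕ) ≠ l+1 by omega)]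
      simpa using hasDerivAt_const (ρ (l+1)) (Real.log (ρ 0))
  | some 0 =>
    change HasDerivAt (fun t => ev (Function.update ρ l t) xx) (ev ρ (da (l+1) xx) / _) _
    simp only [ev_xx, das_xx]
    cases l with
    | zero =>
      have := hasDerivAt_inv h0
      simp only [Function.update_self, if_true, map_mul, ev_xx, map_ofNat, map_neg, map_pow]
      refine HasDerivAt.congr_deriv this ?_
      field_simp; norm_num
    | succ l =>
      simp only [Function.update_of_ne (show (0:ℕ) ≠ l+1 by omega)]
      simpa using hasDerivAt_const (ρ (l+1)) ((ρ 0)⁻¹)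
  | some (m+1) =>
    change HasDerivAt (fun t => ev (Function.update ρ l t) (xi (m+1))) (ev ρ (da (l+1) (xi (m+1))) / _) _
    have e : ∀ t, ev (Function.update ρ l t) (xi (m+1)) = Function.update ρ l t (m+1) / Function.update ρ l t 0 := by
      intro t
      simp [ev, xi, evf]
    simp only [e, das_xi]
    cases l with
    | zero =>
      simp only [Function.update_self, Function.update_of_ne (show m+1 ≠ 0 by omega)]
      have := (hasDerivAt_inv h0).const_mul (ρ (m+1))
      simp only [div_eq_mul_inv]
      refine HasDerivAt.congr_deriv this ?_
      simp only [Nat.succ_ne_zero, if_false, if_true, map_sub, map_mul, map_zero, ev_xx, ev_xi ρ h0, map_ofNat]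
      field_simp; norm_num
    | succ l =>
      simp only [Function.update_of_ne (show (0:ℕ) ≠ l+1 by omega), Nat.succ_ne_zero, if_false, sub_zero]
      by_cases hml : m = l
      · subst hml
        simp only [Function.update_self, if_true]
        have := (hasDerivAt_id (ρ (m+1))).div_const (ρ 0)
        refine HasDerivAt.congr_deriv this ?_
        have e2 : (2 * (((m+1:ℕ):A)) + 3) = MvPolynomial.C (2*((m+1:ℕ):ℚ)+3) := by
          rw [map_add, map_mul, map_natCast, map_ofNat, map_ofNat]
        rw [e2, map_mul, ev_C, ev_xx]
        have : (2*((m+1:ℕ):ℝ)+3) ≠ 0 := by positivity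
        push_cast at this ⊢
        field_simp
      · rw [if_neg (by omega), map_zero, zero_div]
        simp only [Function.update_of_ne (show m+1 ≠ l+1 by omega)]
        exact hasDerivAt_const _ _

lemma ev_deriv (ρ : ℕ → ℝ) (h0 : ρ 0 ≠ 0) (l : ℕ) (f : A) :
    HasDerivAt (fun t => ev (Function.update ρ l t) f)
      (ev ρ (da (l+1) f) / (2*(l:ℝ)+3)) (ρ l) := by
  induction f using MvPolynomial.induction_on with
  | C c =>
    simp only [ev_C, D_C, map_zero, zero_div]
    exact hasDerivAt_const _ _
  | add p q hp hq =>
    simp only [map_add, add_div]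
    exact hp.add hq
  | mul_X p i hp =>
    have := hp.mul (evf_deriv ρ h0 l i)
    simp only [Function.update_eq_self] at this
    rw [D_mul]
    simp only [map_mul, map_add]
    refine HasDerivAt.congr_deriv this ?_
    ring

lemma pdR_ev (c : (ℕ → ℝ) → ℝ) (κ : ℝ) (f : A) (hc : ∀ σ : ℕ → ℝ, σ 0 ≠ 0 → c σ = κ * ev σ f)
    (ρ : ℕ → ℝ) (h0 : ρ 0 ≠ 0) (l : ℕ) :
    pdR c l ρ = κ * (ev ρ (da (l+1) f) / (2*(l:ℝ)+3)) := by
  rw [pdR]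
  have h1 := (ev_deriv ρ h0 l f).const_mul κ
  have h2 : (fun t => c (Function.update ρ l t)) =ᶠ[nhds (ρ l)] (fun t => κ * ev (Function.update ρ l t) f) := by
    cases l with
    | zero =>
      filter_upwards [isOpen_ne.mem_nhds h0] with t ht
      exact hc _ (by simpa using ht)
    | succ l =>
      filter_upwards with t
      exact hc _ (by rw [Function.update_of_ne (by omega)]; exact h0)
  exact (h1.congr_of_eventuallyEq h2).deriv

lemma tsum_range {B : Type*} [AddCommMonoid B] [TopologicalSpace B] [T2Space B] (t : ℕ → B) (L : ℕ)
    (h : ∀ l ≥ L, t l = 0) : ∑' l, t l = ∑ l ∈ Finset.range L, t l :=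
  tsum_eq_sum (fun l hl => h l (by simpa using hl))

lemma a0_sum (f : A) : ∃ K, ∀ L ≥ K,
    ∑ l ∈ Finset.range L, (-xi (l+1)) * da (l+1) f = da 0 f := by
  have := stab (fun L => ∑ j ∈ Finset.range L, (-xi (j+1)) • da (j+1)) (da 0) ⟨1, fun L hL => ?_⟩
    ⟨1, fun L hL => ?_⟩ (fun l => ⟨l+1, fun L hL => ?_⟩) f
  · obtain ⟨K, hK⟩ := this
    refine ⟨K, fun L hL => ?_⟩
    rw [← hK L hL]
    exact (sum_apply _ (fun j => -xi (j+1)) (fun j => da (j+1)) f).symm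
  · rw [sum_apply _ (fun j => -xi (j+1)) (fun j => da (j+1))]
    obtain ⟨m, rfl⟩ := Nat.exists_eq_add_of_le' hL
    rw [Finset.sum_range_succ']
    simp only [das_ell, Nat.succ_ne_zero, if_false, mul_zero, Finset.sum_const_zero, if_true, da0_ell, zero_add]
    ring
  · rw [sum_apply _ (fun j => -xi (j+1)) (fun j => da (j+1))]
    obtain ⟨m, rfl⟩ := Nat.exists_eq_add_of_le' hL
    rw [Finset.sum_range_succ']
    simp only [das_xx, Nat.succ_ne_zero, if_false, mul_zero, Finset.sum_const_zero, if_true, da0_xx, zero_add]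
    ring
  · rw [sum_apply _ (fun j => -xi (j+1)) (fun j => da (j+1))]
    simp only [das_xi, mul_sub, Finset.sum_sub_distrib, mul_ite, mul_zero]
    rw [Finset.sum_ite_eq (Finset.range L) l, Finset.sum_ite_eq' (Finset.range L) 0,
      if_pos (by simp; omega), if_pos (by simp; omega), da0_xi]
    ring

lemma Eul_sum' (f : A) : ∃ K, ∀ L ≥ K,
    ∑ l ∈ Finset.range L, (MvPolynomial.C (1/(2*(l:ℚ)+3)) * xi l) * da (l+1) f = xx * Eul f := by
  have := stab (fun L => ∑ l ∈ Finset.range L, (MvPolynomial.C (1/(2*(l:ℚ)+3)) * xi l) • da (l+1)) (xx • Eul)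
    ⟨1, fun L hL => ?_⟩ ⟨1, fun L hL => ?_⟩ (fun l => ⟨l+1, fun L hL => ?_⟩) f
  · obtain ⟨K, hK⟩ := this
    refine ⟨K, fun L hL => ?_⟩
    refine Eq.trans ?_ (hK L hL)
    exact (sum_apply _ (fun l => MvPolynomial.C (1/(2*(l:ℚ)+3)) * xi l) (fun j => da (j+1)) f).symm
  all_goals
    rw [sum_apply _ (fun l => MvPolynomial.C (1/(2*(l:ℚ)+3)) * xi l) (fun j => da (j+1)), Derivation.smul_apply,
      smul_eq_mul]
  · obtain ⟨m, rfl⟩ := Nat.exists_eq_add_of_le' hL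
    rw [Finset.sum_range_succ']
    simp only [das_ell, Nat.succ_ne_zero, if_false, mul_zero, Finset.sum_const_zero, if_true, Eul_ell, zero_add, xi_zero]
    have := cC 0
    simp only [Nat.cast_zero, mul_zero, zero_add] at this ⊢
    linear_combination xx * this
  · obtain ⟨m, rfl⟩ := Nat.exists_eq_add_of_le' hL
    rw [Finset.sum_range_succ']
    simp only [das_xx, Nat.succ_ne_zero, if_false, mul_zero, Finset.sum_const_zero, if_true, Eul_xx, zero_add, xi_zero]
    have := cC 0
    simp only [Nat.cast_zero, mul_zero, zero_add] at this ⊢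
    linear_combination (-xx^2) * this
  · simp only [das_xi, mul_sub, Finset.sum_sub_distrib, mul_ite, mul_zero]
    rw [Finset.sum_ite_eq (Finset.range L) l, Finset.sum_ite_eq' (Finset.range L) 0,
      if_pos (by simp; omega), if_pos (by simp; omega), Eul_xi, xi_zero]
    have h1 := cC 0
    have h2 := cC l
    simp only [Nat.cast_zero, mul_zero, zero_add] at h1 ⊢
    linear_combination xx * xi l * h2 - xx * xi l * h1

lemma ev_a0 (ρ : ℕ → ℝ) (h0 : ρ 0 ≠ 0) (f : A) : ∃ K, ∀ L ≥ K,
    ∑ l ∈ Finset.range L, -(ρ (l+1) / ρ 0) * ev ρ (da (l+1) f) = ev ρ (da 0 f) := by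
  obtain ⟨K, hK⟩ := a0_sum f
  refine ⟨K, fun L hL => ?_⟩
  rw [← hK L hL, map_sum]
  apply Finset.sum_congr rfl
  intro l _
  rw [map_mul, map_neg, ev_xi ρ h0]

lemma ev_Eul (ρ : ℕ → ℝ) (h0 : ρ 0 ≠ 0) (f : A) : ∃ K, ∀ L ≥ K,
    ∑ l ∈ Finset.range L, ρ l * (ev ρ (da (l+1) f) / (2*(l:ℝ)+3)) = ev ρ (Eul f) := by
  obtain ⟨K, hK⟩ := Eul_sum' f
  refine ⟨K, fun L hL => ?_⟩
  have h := congrArg (ev ρ) (hK L hL)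
  rw [map_sum, map_mul, ev_xx] at h
  have : ev ρ (Eul f) = ρ 0 * ((ρ 0)⁻¹ * ev ρ (Eul f)) := by field_simp
  rw [this, ← h, Finset.mul_sum]
  apply Finset.sum_congr rfl
  intro l _
  rw [map_mul, map_mul, ev_C, ev_xi ρ h0]
  push_cast
  field_simp

end Aux9

end PGnc

end PGsec

section PHsec


set_option linter.unusedSimpArgs false
set_option linter.unusedSectionVars false

noncomputable section PHnc

namespace Aux9

open NCQFT

lemma dsum_shift (p c : ℕ) (φ : ℕ → ℕ → ℝ) :
    ∑ i ∈ Finset.range (p+c+1), ∑ j ∈ Finset.range (p+c+1), (if i + j + c = p + c then φ i j else 0)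
      = ∑ i ∈ Finset.range (p+1), φ i (p-i) := by
  have h1 : ∀ i ∈ Finset.range (p+c+1), ∑ j ∈ Finset.range (p+c+1), (if i + j + c = p + c then φ i j else 0)
      = if i ≤ p then φ i (p-i) else 0 := by
    intro i _
    split_ifs with h
    · rw [Finset.sum_eq_single (p-i)]
      · rw [if_pos (by omega)]
      · intro j _ hj; rw [if_neg (by omega)]
      · intro hn; simp at hn; omega
    · apply Finset.sum_eq_zero
      intro j _; rw [if_neg (by omega)]
  rw [Finset.sum_congr rfl h1, ← Finset.sum_filter]
  congr 1
  ext i; simp; omega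

lemma antidiag_Icc (n : ℕ) (φ : ℕ → ℕ → A) (h1 : φ 0 (n+1) = 0) (h2 : φ (n+1) 0 = 0) :
    ∑ p ∈ Finset.HasAntidiagonal.antidiagonal (n+1), φ p.1 p.2 = ∑ h ∈ Finset.Icc 1 n, φ h (n+1-h) := by
  rw [Finset.Nat.sum_antidiagonal_eq_sum_range_succ_mk, Finset.sum_range_succ, Finset.sum_range_succ']
  simp only [Nat.sub_self, h2, add_zero, Nat.sub_zero, h1]
  symm
  rw [← Finset.sum_image (s := Finset.range n) (g := fun k => k+1) (f := fun h => φ h (n+1-h)) (by intro a _ b _ h; simpa using h)]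
  congr 1
  ext h; simp only [Finset.mem_Icc, Finset.mem_image, Finset.mem_range]
  constructor
  · intro hh; exact ⟨h-1, by omega, by omega⟩
  · rintro ⟨a, ha, rfl⟩; omega

lemma tsum_a0 (ρ : ℕ → ℝ) (h0 : ρ 0 ≠ 0) (c : (ℕ → ℝ) → ℝ) (κ : ℝ) (f : A)
    (hc : ∀ σ : ℕ → ℝ, σ 0 ≠ 0 → c σ = κ * ev σ f) :
    -(1 / ρ 0) * ∑' l : ℕ, (3 + 2 * (l : ℝ)) * ρ (l + 1) * pdR c l ρ = κ * ev ρ (da 0 f) := by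
  obtain ⟨K1, hK1⟩ := ev_a0 ρ h0 f
  obtain ⟨K2, hK2⟩ := da_van f
  rw [tsum_range _ (K1 + K2), ← hK1 (K1+K2) (by omega), Finset.mul_sum, Finset.mul_sum]
  · apply Finset.sum_congr rfl
    intro l _
    rw [pdR_ev c κ f hc ρ h0]
    have : 2*(l:ℝ)+3 ≠ 0 := by positivity
    field_simp
    ring
  · intro l hl
    rw [pdR_ev c κ f hc ρ h0, hK2 (l+1) (by omega)]; simp

lemma eBr_eq (lam : ℝ) (n : ℕ) (hn : 1 ≤ n) (f : ℕ → A) (hf0 : f 0 = 0) (prev : ℕ → ℕ → (ℕ → ℝ) → ℝ)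
    (hp : ∀ h, 1 ≤ h → h ≤ n → ∀ k, ∀ σ : ℕ → ℝ, σ 0 ≠ 0 → prev h k σ = (2*lam)^(4*h) * ev σ (da k (f h)))
    (m : ℕ) (ρ : ℕ → ℝ) (h0 : ρ 0 ≠ 0) :
    eBr lam (n+1) prev m ρ = (2*lam)^(4*(n+1)) * ev ρ (Eb f n m) := by
  match m with
  | 0 => simp [eBr, Eb]
  | 1 =>
    have : ∀ i j, ¬ (i + j + 2 = 1) := by intros; omega
    have h' : ∀ i j, ¬ (i + j + 3 = 1) := by intros; omega
    simp [eBr, Eb, Ee]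
  | (p+2) =>
    have T1 : (∑ h ∈ Finset.Icc 1 n, ∑ i ∈ Finset.range (p + 2 + 1), ∑ j ∈ Finset.range (p + 2 + 1),
        if i + j + 2 = p + 2 then prev h i ρ * prev (n + 1 - h) j ρ else 0) =
        (2*lam)^(4*(n+1)) * ev ρ (∑ i ∈ Finset.range (p+1),
          ∑ q ∈ Finset.HasAntidiagonal.antidiagonal (n+1), da i (f q.1) * da (p - i) (f q.2)) := by
      have e1 : ∀ i ∈ Finset.range (p+1), ∑ q ∈ Finset.HasAntidiagonal.antidiagonal (n+1), da i (f q.1) * da (p - i) (f q.2)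
         = ∑ h ∈ Finset.Icc 1 n, da i (f h) * da (p-i) (f (n+1-h)) := by
        intro i _
        apply antidiag_Icc n (fun a b => da i (f a) * da (p-i) (f b)) <;> simp [hf0]
      rw [Finset.sum_congr rfl e1, Finset.sum_comm (s := Finset.range (p+1)) (t := Finset.Icc 1 n)
        (f := fun i h => da i (f h) * da (p-i) (f (n+1-h))), map_sum, Finset.mul_sum]
      apply Finset.sum_congr rfl
      intro h hh
      rw [Finset.mem_Icc] at hh
      rw [dsum_shift p 2 (fun i j => prev h i ρ * prev (n+1-h) j ρ), map_sum, Finset.mul_sum]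
      apply Finset.sum_congr rfl
      intro i _
      rw [hp h hh.1 hh.2 i ρ h0, hp (n+1-h) (by omega) (by omega) _ ρ h0, map_mul,
        show 4 * (n+1) = 4 * h + 4 * (n+1-h) by omega, pow_add]
      ring
    have T2 : -(1 / ρ 0) * ∑' l : ℕ, (3 + 2 * (l : ℝ)) * ρ (l + 1) * pdR (prev n p) l ρ =
        (2*lam)^(4*n) * ev ρ (da 0 (da p (f n))) :=
      tsum_a0 ρ h0 _ _ _ (hp n hn le_rfl p)
    have T3 : (∑ k ∈ Finset.range (p + 2 + 1), ∑ l ∈ Finset.range (p + 2 + 1),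
        if k + l + 3 = p + 2 then (3 + 2 * (l : ℝ)) * pdR (prev n k) l ρ else 0) =
        (2*lam)^(4*n) * ev ρ (∑ i ∈ Finset.range p, da (i+1) (da (p-(i+1)) (f n))) := by
      cases p with
      | zero =>
        have : ∀ i j, ¬ (i + j + 3 = 2) := by intros; omega
        simp [this]
      | succ q =>
        have := dsum_shift q 3 (fun k l => (3 + 2 * (l : ℝ)) * pdR (prev n k) l ρ)
        rw [show q + 1 + 2 + 1 = q + 3 + 1 by omega, show q + 1 + 2 = q + 3 by omega, this,
          ← Finset.sum_range_reflect, map_sum, Finset.mul_sum]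
        apply Finset.sum_congr rfl
        intro i hi
        rw [Finset.mem_range] at hi
        rw [pdR_ev _ _ _ (hp n hn le_rfl _) ρ h0, show q - (q + 1 - 1 - i) = i by omega,
          show q + 1 - 1 - i = q + 1 - (i+1) by omega]
        have : 2*(i:ℝ)+3 ≠ 0 := by positivity
        field_simp
        ring
    have T4 : ∑ i ∈ Finset.range (p+1), VA.W (f n) i (p-i) =
        VA.W (f n) 0 p + ∑ i ∈ Finset.range p, da (i+1) (da (p-(i+1)) (f n)) := by
      rw [Finset.sum_range_succ', add_comm]
      rfl
    have T5 : ev ρ (VA.W (f n) 0 p) * (2*lam)^(4*n) = (2*lam)^(4*n) * ev ρ (da 0 (da p (f n))) +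
        (if 3 ≤ p + 2 then -(((2 * (p + 2 - 3) + 3 : ℕ) : ℝ) * prev n (p + 2 - 3) ρ) / ρ 0 else 0) := by
      cases p with
      | zero =>
        rw [if_neg (by omega), add_zero, mul_comm]; rfl
      | succ q =>
        rw [if_pos (by omega), show q + 1 + 2 - 3 = q by omega, hp n hn le_rfl _ ρ h0]
        change ev ρ (da (q+1) (da 0 (f n))) * _ = _
        have e2 : (2 * (q:A) + 3) = MvPolynomial.C (2*(q:ℚ)+3) := by
          rw [map_add, map_mul, map_natCast, map_ofNat, map_ofNat]
        rw [da_a0, e2, map_sub, map_mul, map_mul, ev_C, ev_xx]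
        push_cast
        field_simp
        ring
    have e4 : (2*lam)^(4*(n+1)) = (2*lam)^4 * (2*lam)^(4*n) := by rw [← pow_add]; congr 1; ring
    rw [eBr, Eb, Ee, Finset.sum_add_distrib, map_add, mul_add]
    simp only [Nat.add_sub_cancel]
    rw [T1, T2, T3, T4, map_add, if_pos (by omega : 2 ≤ p + 2), e4]
    linear_combination (-(2*lam)^4) * T5

lemma Gtab_mono (lam : ℝ) (h H : ℕ) (h1 : 1 ≤ h) (hH : h ≤ H) : Gtab lam H h = Gtab lam h h := by
  induction H with
  | zero => omega
  | succ H ih =>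
    rcases Nat.lt_or_ge H h with h2 | h2
    · have : h = H + 1 := by omega
      rw [this]
    · rw [← ih h2]
      match H, h2 with
      | 0, h2 => omega
      | (G+1), h2 =>
        funext k ρ
        rw [Gtab]
        exact if_pos h2

theorem Gtab_eq (lam : ℝ) {G : ℕ} {f : ℕ → A} (hf : Good G f) (h : ℕ) (h1 : 1 ≤ h) (h2 : h ≤ G) (k : ℕ)
    (ρ : ℕ → ℝ) (h0 : ρ 0 ≠ 0) : Gtab lam h h k ρ = (2*lam)^(4*h) * ev ρ (da k (f h)) := by
  induction h using Nat.strong_induction_on generalizing k ρ with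
  | _ h ih =>
    match h, h1, h2, ih with
    | 1, _, _, _ =>
      rw [Gtab]
      beta_reduce
      rw [if_pos rfl, hf.f1, D_C_mul, map_mul, ev_C]
      match k with
      | 0 =>
        rw [if_pos rfl, da0_ell, map_mul, map_mul, ev_xx, ev_xi ρ h0, map_neg, map_ofNat]
        push_cast; field_simp; ring
      | 1 =>
        rw [if_neg (by omega), if_pos rfl, da1_ell, map_mul, ev_xx, map_ofNat]
        push_cast; field_simp; ring
      | (k+2) =>
        rw [if_neg (by omega), if_neg (by omega), da2_ell, map_zero]; ring
    | (n+2), _, h2, ih =>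
      rw [Gtab]
      beta_reduce
      rw [if_neg (by omega), if_pos rfl]
      have hp : ∀ h, 1 ≤ h → h ≤ n+1 → ∀ k, ∀ σ : ℕ → ℝ, σ 0 ≠ 0 →
          Gtab lam (n+1) h k σ = (2*lam)^(4*h) * ev σ (da k (f h)) := by
        intro h hh1 hh2 k σ hσ
        rw [Gtab_mono lam h (n+1) hh1 hh2]
        exact ih h (by omega) hh1 (by omega) k σ hσ
      have hE := eBr_eq lam (n+1) (by omega) f hf.f0 _ hp
      obtain ⟨K1, hK1⟩ := da_form hf (n+1) (by omega) (by omega) k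
      obtain ⟨K2, hK2⟩ := Eb_van f (n+1)
      rw [tsum_range _ (K1+K2)]
      · have e := congrArg (ev ρ) (hK1 (K1+K2) (by omega))
        rw [map_mul, map_neg, map_mul, map_sum, ev_xx, map_ofNat] at e
        have e3 : ∀ j ∈ Finset.range (K1+K2), eBr lam (n + 2) (Gtab lam (n + 1)) (k + j) ρ * Sm ρ j / (j.factorial : ℝ)
          = (2*lam)^(4*(n+2)) * ev ρ (Eb f (n+1) (k+j) * sc j) := by
          intro j _
          rw [hE (k+j) ρ h0, map_mul, ev_sc ρ h0]
          ring
        rw [Finset.sum_congr rfl e3, ← Finset.mul_sum]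
        have e5 : (1/(2 * ρ 0)) = (ρ 0)⁻¹ / 2 := by field_simp
        rw [e5]
        linear_combination (-(2*lam)^(4*(n+2))/2) * e
      · intro l hl
        rw [hE (k+l) ρ h0, hK2 (k+l) (by omega)]; simp

lemma Ffree_eq (lam : ℝ) (hlam : lam ≠ 0) {G : ℕ} {f : ℕ → A} (hf : Good G f) (h : ℕ) (h1 : 1 ≤ h) (h2 : h ≤ G)
    (ρ : ℕ → ℝ) (h0 : ρ 0 ≠ 0) : Ffree lam h ρ = (2*lam)^(4*h-4) * ev ρ (f h) := by
  rw [Ffree]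
  split_ifs with hh
  · subst hh
    rw [hf.f1, map_mul, ev_C, ev_ell]
    push_cast; ring
  · obtain ⟨K1, hK1⟩ := ev_Eul ρ h0 (f h)
    obtain ⟨K2, hK2⟩ := da_van (f h)
    have hg := Gtab_eq lam hf h h1 h2
    rw [AcheckG, tsum_range _ (K1+K2)]
    · have e := hK1 (K1+K2) (by omega)
      have e3 : ∀ l ∈ Finset.range (K1+K2), ρ l / (3 + 2 * (l : ℝ)) * Gcoef lam h (l + 1) ρ
          = (2*lam)^(4*h) * (ρ l * (ev ρ (da (l+1) (f h)) / (2*(l:ℝ)+3))) := by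
        intro l _
        rw [Gcoef, hg _ ρ h0]
        have : 2*(l:ℝ)+3 ≠ 0 := by positivity
        rw [add_comm (3:ℝ)]
        field_simp
      rw [Finset.sum_congr rfl e3, ← Finset.mul_sum, e, hf.hE' h (by omega), map_mul]
      have e2 : (2 - 2 * (h:A)) = MvPolynomial.C (2 - 2*(h:ℚ)) := by
        rw [map_sub, map_mul, map_natCast, map_ofNat]
      rw [e2, ev_C]
      have e4 : (2*lam)^(4*h) = (2*lam)^4 * (2*lam)^(4*h-4) := by rw [← pow_add]; congr 1; omega
      rw [e4]
      have hx : (2*(h:ℝ)-2) ≠ 0 := by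
        have : (2:ℝ) ≤ h := by exact_mod_cast (by omega : 2 ≤ h)
        linarith
      have hy : (2*lam)^4 ≠ 0 := by positivity
      have e5 : (((2 - 2 * (h:ℚ) : ℚ)) : ℝ) = -(2*(h:ℝ)-2) := by push_cast; ring
      rw [e5]
      generalize (2*(h:ℝ)-2) = x at *
      generalize (2*lam)^4 = y at *
      generalize (2*lam)^(4*h-4) = z at *
      generalize ev ρ (f h) = q at *
      field_simp
    · intro l hl
      rw [Gcoef, hg _ ρ h0, hK2 (l+1) (by omega)]; simp

end Aux9

end PHnc

end PHsec

section PIsec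


set_option linter.unusedSimpArgs false
set_option linter.unusedSectionVars false

noncomputable section PInc

namespace Aux9

open NCQFT

lemma ctsum_range (t : ℕ → ℂ) (L : ℕ) (h : ∀ l ≥ L, t l = 0) : ∑' l, t l = ∑ l ∈ Finset.range L, t l :=
  tsum_eq_sum (fun l hl => h l (by simpa using hl))

lemma adag_fin (F : (ℕ → ℝ) → ℝ) (ρ : ℕ → ℝ) (z : ℂ) (hz : z ≠ 0) (h0 : ρ 0 ≠ 0) (L : ℕ)
    (h : ∀ l ≥ L, pdR F l ρ = 0) :
    AdagScalar F ρ z = ((-(1 / ρ 0) * ∑ l ∈ Finset.range L, (3 + 2 * (l : ℝ)) * ρ (l + 1) * pdR F l ρ : ℝ) : ℂ) / z^3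
      + ∑ l ∈ Finset.range L, (((3 + 2 * (l:ℝ)) * pdR F l ρ : ℝ) : ℂ) / z^(5+2*l) := by
  have h0' : (ρ 0 : ℂ) ≠ 0 := by exact_mod_cast h0
  rw [AdagScalar, ctsum_range _ L]
  · push_cast
    rw [Finset.mul_sum, Finset.sum_div, ← Finset.sum_add_distrib]
    apply Finset.sum_congr rfl
    intro l _
    field_simp
  · intro l hl
    rw [h l hl]; simp

lemma laurent_zero (a0 : ℂ) (a : ℕ → ℂ) (L : ℕ)
    (h : ∀ z : ℂ, z ≠ 0 → a0 / z^3 + ∑ l ∈ Finset.range L, a l / z^(5+2*l) = 0) :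
    ∀ l < L, a l = 0 := by
  have hp : Polynomial.C a0 * Polynomial.X^3 + ∑ l ∈ Finset.range L, Polynomial.C (a l) * Polynomial.X^(5+2*l) = 0 := by
    apply Polynomial.funext
    intro w
    rw [Polynomial.eval_add, Polynomial.eval_finset_sum]
    simp only [Polynomial.eval_mul, Polynomial.eval_C, Polynomial.eval_pow, Polynomial.eval_X, Polynomial.eval_zero]
    by_cases hw : w = 0
    · subst hw
      rw [Finset.sum_eq_zero]
      · simp
      · intro l _
        rw [zero_pow (by omega)]; simp
    · have := h w⁻¹ (inv_ne_zero hw)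
      simpa [inv_pow, div_inv_eq_mul] using this
  intro l hl
  have := congrArg (fun p => Polynomial.coeff p (5+2*l)) hp
  simp only [Polynomial.coeff_add, Polynomial.finset_sum_coeff, Polynomial.coeff_C_mul, Polynomial.coeff_X_pow,
    Polynomial.coeff_zero] at this
  rw [if_neg (by omega), Finset.sum_eq_single l] at this
  · simpa using this
  · intro b _ hb
    rw [if_neg (by omega)]; simp
  · intro hh; simp at hh; omega

lemma part1 (lam : ℝ) (hlam : lam ≠ 0) {g : ℕ} {f : ℕ → A} (hf : Good g f) (hg : 1 ≤ g)
    (ρ : ℕ → ℝ) (h0 : ρ 0 ≠ 0) (z : ℂ) (hz : z ≠ 0) :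
    (2 * (lam : ℂ)) ^ 4 * AdagScalar (Ffree lam g) ρ z = Gfun lam g ρ z := by
  have hF := Ffree_eq lam hlam hf g hg le_rfl
  have hG := Gtab_eq lam hf g hg le_rfl
  have hpd := pdR_ev (Ffree lam g) _ (f g) hF ρ h0
  obtain ⟨K1, hK1⟩ := da_van (f g)
  have hv : ∀ l ≥ K1, pdR (Ffree lam g) l ρ = 0 := by
    intro l hl
    rw [hpd, hK1 (l+1) (by omega)]; simp
  have ht := tsum_a0 ρ h0 (Ffree lam g) _ (f g) hF
  rw [tsum_range _ K1 (by intro l hl; rw [hv l hl]; simp)] at ht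
  rw [adag_fin _ ρ z hz h0 K1 hv, ht, Gfun, ctsum_range _ (K1+1), Finset.sum_range_succ']
  · have e4 : (2*lam)^(4*g) = (2*lam)^4 * (2*lam)^(4*g-4) := by rw [← pow_add]; congr 1; omega
    have e0 : Gcoef lam g 0 ρ = (2*lam)^4 * ((2*lam)^(4*g-4) * ev ρ (da 0 (f g))) := by
      rw [Gcoef, hG 0 ρ h0, e4]; ring
    have e1 : ∀ l, Gcoef lam g (l+1) ρ = (2*lam)^4 * ((3 + 2 * (l:ℝ)) * pdR (Ffree lam g) l ρ) := by
      intro l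
      rw [Gcoef, hG (l+1) ρ h0, e4, hpd]
      have : 2*(l:ℝ)+3 ≠ 0 := by positivity
      field_simp
      ring
    rw [e0, mul_add, add_comm, Finset.mul_sum]
    congr 1
    · apply Finset.sum_congr rfl
      intro l _
      rw [e1, show 2*(l+1)+3 = 5+2*l by ring]
      push_cast
      ring
    · push_cast
      ring
  · intro l hl
    rw [Gcoef, hG l ρ h0, hK1 l (by omega)]; simp

lemma pdR_fam {M : ℕ} {F : (ℕ → ℝ) → ℝ} (hF : SmoothScalarFam M F) (ρ : ℕ → ℝ) (l : ℕ) (hl : l ≥ M+1) :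
    pdR F l ρ = 0 := by
  obtain ⟨Ft, _, h⟩ := hF
  have : (fun t => F (Function.update ρ l t)) = fun _ => F ρ := by
    funext t
    rw [h, h]
    congr 1
    funext i
    rw [Function.update_of_ne]
    have := i.2
    omega
  rw [pdR, this]
  simp

lemma part2 (lam : ℝ) (hlam : lam ≠ 0) {g : ℕ} {f : ℕ → A} (hf : Good g f) (hg : 2 ≤ g)
    (F : (ℕ → ℝ) → ℝ) (M : ℕ) (hM : SmoothScalarFam M F)
    (ρ : ℕ → ℝ) (h0 : ρ 0 ≠ 0) 
    (hA : ∀ z : ℂ, z ≠ 0 → (2 * (lam : ℂ)) ^ 4 * AdagScalar F ρ z = Gfun lam g ρ z)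
    (hN : (-∑' l : ℕ, ρ l * pdR F l ρ) = (2 * (g : ℝ) - 2) * F ρ) : F ρ = Ffree lam g ρ := by
  have hFr := Ffree_eq lam hlam hf g (by omega) le_rfl
  have hpd := pdR_ev (Ffree lam g) _ (f g) hFr ρ h0
  obtain ⟨K1, hK1⟩ := da_van (f g)
  obtain ⟨K2, hK2⟩ := ev_Eul ρ h0 (f g)
  have hv : ∀ l ≥ K1, pdR (Ffree lam g) l ρ = 0 := by
    intro l hl
    rw [hpd, hK1 (l+1) (by omega)]; simp
  have hv' := pdR_fam hM ρ
  have key : ∀ l, pdR F l ρ = pdR (Ffree lam g) l ρ := by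
    intro l
    by_cases hl : l < K1 + (M+1)
    · have := laurent_zero (a := fun l : ℕ => (((3 + 2 * (l:ℝ)) * pdR F l ρ : ℝ) : ℂ) - (((3 + 2 * (l:ℝ)) * pdR (Ffree lam g) l ρ : ℝ) : ℂ)) (L := K1 + (M+1)) (a0 := 
          ((-(1 / ρ 0) * ∑ l ∈ Finset.range (K1+(M+1)), (3 + 2 * (l : ℝ)) * ρ (l + 1) * pdR F l ρ : ℝ) : ℂ) -
          ((-(1 / ρ 0) * ∑ l ∈ Finset.range (K1+(M+1)), (3 + 2 * (l : ℝ)) * ρ (l + 1) * pdR (Ffree lam g) l ρ : ℝ) : ℂ)) ?_ l hl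
      · have h3 : (3 + 2 * (l:ℝ)) ≠ 0 := by positivity
        rw [sub_eq_zero, Complex.ofReal_inj] at this
        exact mul_left_cancel₀ h3 this
      · intro z hz
        have e1 := adag_fin F ρ z hz h0 (K1+(M+1)) (fun l hl => hv' l (by omega))
        have e2 := adag_fin (Ffree lam g) ρ z hz h0 (K1+(M+1)) (fun l hl => hv l (by omega))
        have e3 : AdagScalar F ρ z = AdagScalar (Ffree lam g) ρ z := by
          have hne : (2 * (lam : ℂ)) ^ 4 ≠ 0 := by
            have : (lam : ℂ) ≠ 0 := by exact_mod_cast hlam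
            exact pow_ne_zero _ (mul_ne_zero two_ne_zero this)
          apply mul_left_cancel₀ hne
          rw [hA z hz, part1 lam hlam hf (by omega) ρ h0 z hz]
        rw [e1, e2] at e3
        simp only [sub_div, Finset.sum_sub_distrib]
        linear_combination e3
    · rw [hv l (by omega), hv' l (by omega)]
  have hx : (2*(g:ℝ)-2) ≠ 0 := by
    have : (2:ℝ) ≤ g := by exact_mod_cast hg
    linarith
  apply mul_left_cancel₀ hx
  rw [← hN, tsum_range _ (K1+K2) (by intro l hl; rw [key, hv l (by omega)]; simp)]
  have e := hK2 (K1+K2) (by omega)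
  have e3 : ∀ l ∈ Finset.range (K1+K2), ρ l * pdR F l ρ
      = (2*lam)^(4*g-4) * (ρ l * (ev ρ (da (l+1) (f g)) / (2*(l:ℝ)+3))) := by
    intro l _
    rw [key, hpd]; ring
  have e2 : (2 - 2 * (g:A)) = MvPolynomial.C (2 - 2*(g:ℚ)) := by
    rw [map_sub, map_mul, map_natCast, map_ofNat]
  rw [Finset.sum_congr rfl e3, ← Finset.mul_sum, e, hf.hE' g hg, map_mul, e2, ev_C, hFr ρ h0]
  push_cast
  ring

end Aux9

end PInc

end PIsec

section PJsec


set_option linter.unusedSimpArgs false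
set_option linter.unusedSectionVars false

noncomputable section PJnc

namespace Aux9

open NCQFT

lemma diag_coeff (D : Derivation ℚ A A) (c : Option ℕ → ℚ)
    (hD : ∀ i, D (MvPolynomial.X i) = MvPolynomial.C (c i) * MvPolynomial.X i) (f : A) :
    ∀ m : Option ℕ →₀ ℕ, MvPolynomial.coeff m (D f) = (m.sum fun i k => (k:ℚ) * c i) * MvPolynomial.coeff m f := by
  induction f using MvPolynomial.induction_on with
  | C a =>
    intro m
    rw [D_C, MvPolynomial.coeff_zero, MvPolynomial.coeff_C]
    split_ifs with h
    · subst h; simp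
    · simp
  | add p q hp hq =>
    intro m
    rw [map_add, MvPolynomial.coeff_add, MvPolynomial.coeff_add, hp, hq]; ring
  | mul_X p i hp =>
    intro m
    have e : D (p * MvPolynomial.X i) = MvPolynomial.C (c i) * (p * MvPolynomial.X i) + D p * MvPolynomial.X i := by
      rw [Derivation.leibniz, hD, smul_eq_mul, smul_eq_mul]; ring
    rw [e, MvPolynomial.coeff_add, MvPolynomial.coeff_C_mul, MvPolynomial.coeff_mul_X', MvPolynomial.coeff_mul_X']
    split_ifs with h
    · rw [hp]
      have hm : m = (m - Finsupp.single i 1) + Finsupp.single i 1 := by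
        rw [tsub_add_cancel_of_le]
        rw [Finsupp.single_le_iff]
        rw [Finsupp.mem_support_iff] at h
        omega
      have e2 : (m.sum fun i k => (k:ℚ) * c i) = ((m - Finsupp.single i 1).sum fun i k => (k:ℚ) * c i) + c i := by
        conv_lhs => rw [hm]
        rw [Finsupp.sum_add_index', Finsupp.sum_single_index]
        · simp
        · simp
        · intro a; simp
        · intro a b1 b2; push_cast; ring
      rw [e2]; ring
    · ring

lemma diag_eig (D : Derivation ℚ A A) (c : Option ℕ → ℚ)
    (hD : ∀ i, D (MvPolynomial.X i) = MvPolynomial.C (c i) * MvPolynomial.X i) (f : A) (q : ℚ)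
    (hf : D f = MvPolynomial.C q * f) (m : Option ℕ →₀ ℕ) (hm : m ∈ f.support) :
    (m.sum fun i k => (k:ℚ) * c i) = q := by
  have h := diag_coeff D c hD f m
  rw [hf, MvPolynomial.coeff_C_mul] at h
  rw [MvPolynomial.mem_support_iff] at hm
  exact (mul_right_cancel₀ hm h).symm

lemma supp_expand {R : Type*} [CommMonoid R] (m : Option ℕ →₀ ℕ) (j : ℕ) (hj : ∀ l, j < l → m (some l) = 0)
    (h : Option ℕ → ℕ → R) (h1 : ∀ i, h i 0 = 1) :
    m.prod h = h none (m none) * (h (some 0) (m (some 0)) *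
      ∏ i : Fin j, h (some ((i:ℕ)+1)) (m (some ((i:ℕ)+1)))) := by
  rw [Finsupp.prod_of_support_subset m (s := insert none ((Finset.range (j+1)).image some))]
  · rw [Finset.prod_insert (by simp), Finset.prod_image (by intro a _ b _ h; simpa using h),
      Finset.prod_range_succ', Finset.prod_range, mul_comm (h (some 0) _)]
  · intro i hi
    rw [Finsupp.mem_support_iff] at hi
    cases i with
    | none => simp
    | some l =>
      have : l < j + 1 := by
        by_contra hc
        exact hi (hj l (by omega))
      simp; omega
  · intro i _; exact h1 i

lemma supp_expand_sum {R : Type*} [AddCommMonoid R] (m : Option ℕ →₀ ℕ) (j : ℕ) (hj : ∀ l, j < l → m (some l) = 0)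
    (h : Option ℕ → ℕ → R) (h1 : ∀ i, h i 0 = 0) :
    m.sum h = h none (m none) + (h (some 0) (m (some 0)) +
      ∑ i : Fin j, h (some ((i:ℕ)+1)) (m (some ((i:ℕ)+1)))) :=
  supp_expand (R := Multiplicative R) m j hj h h1

def cwt : Option ℕ → ℚ
  | none => 0
  | some l => l

def cell : Option ℕ → ℚ
  | none => 1
  | some _ => 0

def czz : Option ℕ → ℚ
  | none => 0
  | some 0 => -1
  | some (_+1) => 0

lemma wt_diag (i : Option ℕ) : wt (MvPolynomial.X i) = MvPolynomial.C (cwt i) * MvPolynomial.X i := by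
  match i with
  | none => simp [wt, mkD, cwt]
  | some 0 => simp [wt, mkD, cwt]
  | some (l+1) => simp [wt, mkD, cwt, xi]

lemma ell_diag (i : Option ℕ) : (ell • dell) (MvPolynomial.X i) = MvPolynomial.C (cell i) * MvPolynomial.X i := by
  match i with
  | none => simp [dell, mkD, cell, ell]
  | some 0 => simp [dell, mkD, cell, ell]
  | some (l+1) => simp [dell, mkD, cell, ell]

lemma zz_diag (i : Option ℕ) : (Eul - dell) (MvPolynomial.X i) = MvPolynomial.C (czz i) * MvPolynomial.X i := by
  match i with
  | none => simp [dell, mkD, czz, Eul]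
  | some 0 => simp [dell, mkD, czz, Eul, xx]
  | some (l+1) => simp [dell, mkD, czz, Eul]

lemma supp_facts {g : ℕ} {f : ℕ → A} (hf : Good g f) (hg : 2 ≤ g) (m : Option ℕ →₀ ℕ) (hm : m ∈ (f g).support) :
    m none = 0 ∧ m (some 0) = 2*g-2 ∧ (∀ l, 3*g-3 < l → m (some l) = 0) ∧
      (∑ i : Fin (3*g-3), ((i:ℕ)+1) * m (some ((i:ℕ)+1))) = 3*g-3 := by
  have hwt : wt (f g) = MvPolynomial.C ((3*g-3 : ℕ) : ℚ) * f g := by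
    obtain ⟨n, rfl⟩ : ∃ n, g = n+1 := ⟨g-1, by omega⟩
    have h1 := hf.hu n (by omega) le_rfl 0
    have h2 : Ee (f) n 0 = 0 := by simp [Ee]
    rw [h2, neg_zero, du0_eq, hf.hE' _ hg] at h1
    have h3 : (((3*(n+1)-3 : ℕ) : ℚ)) = 3*(n:ℚ) := by
      rw [show 3*(n+1)-3 = 3*n by omega]; push_cast; ring
    rw [h3, map_mul, map_natCast, map_ofNat]
    have h4 : (4:A) * wt (f (n+1)) = 4 * (3 * (n:A) * f (n+1)) := by
      push_cast at h1
      linear_combination h1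
    exact mul_left_cancel₀ (by norm_num) h4
  have e1 := diag_eig wt cwt wt_diag (f g) _ hwt m hm
  have e2 := diag_eig (ell • dell) cell ell_diag (f g) 0 (by simp [hf.hl' g hg]) m hm
  have e3 := diag_eig (Eul - dell) czz zz_diag (f g) (2-2*(g:ℚ)) (by
    rw [Derivation.sub_apply, hf.hl' g hg, hf.hE' g hg, sub_zero, map_sub, map_mul, map_natCast, map_ofNat]) m hm
  have hv : ∀ l, 3*g-3 < l → m (some l) = 0 := by
    intro l hl
    by_contra hc
    have hs : some l ∈ m.support := by rwa [Finsupp.mem_support_iff]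
    have hle := Finset.single_le_sum (f := fun i => (m i:ℚ) * cwt i) (s := m.support) (by
      intro i _
      cases i with
      | none => simp [cwt]
      | some l => simp only [cwt]; positivity) hs
    rw [Finsupp.sum] at e1
    rw [e1] at hle
    simp only [cwt] at hle
    have : m (some l) * l ≤ 3*g-3 := by exact_mod_cast hle
    have : 1 * l ≤ m (some l) * l := Nat.mul_le_mul_right _ (by omega)
    omega
  rw [supp_expand_sum m _ hv _ (by intro i; simp)] at e1 e2 e3
  refine ⟨?_, ?_, hv, ?_⟩
  · simpa [cell] using e2
  · simp [czz] at e3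
    have : (m (some 0) : ℚ) = ((2*g-2:ℕ):ℚ) := by
      rw [Nat.cast_sub (by omega)]; push_cast; linarith
    exact_mod_cast this
  · simp only [cwt, mul_zero, zero_add, Nat.cast_zero] at e1
    have e4 : ((∑ i : Fin (3*g-3), ((i:ℕ)+1) * m (some ((i:ℕ)+1)) : ℕ) : ℚ) = ((3*g-3 : ℕ) : ℚ) := by
      rw [← e1]
      push_cast
      apply Finset.sum_congr rfl
      intro i _; ring
    exact_mod_cast e4

lemma part3 (lam : ℝ) (hlam : lam ≠ 0) {g : ℕ} {f : ℕ → A} (hf : Good g f) (hg : 2 ≤ g) :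
    ∃ P : MvPolynomial (Fin (3 * g - 3)) ℚ,
      IsWeighted (3 * g - 3) P ∧
      ∀ ρ : ℕ → ℝ, ρ 0 ≠ 0 →
        Ffree lam g ρ = (2 * lam) ^ (4 * g - 4) *
          (MvPolynomial.aeval (fun i : Fin (3 * g - 3) => ρ ((i : ℕ) + 1) / ρ 0) P) /
            (ρ 0) ^ (2 * g - 2) := by
  classical
  let r : (Option ℕ →₀ ℕ) → (Fin (3*g-3) →₀ ℕ) := fun m =>
    Finsupp.equivFunOnFinite.symm fun i => m (some ((i:ℕ)+1))
  refine ⟨∑ m ∈ (f g).support, MvPolynomial.monomial (r m) (MvPolynomial.coeff m (f g)), ?_, ?_⟩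
  · intro s hs
    have := MvPolynomial.support_sum hs
    rw [Finset.mem_biUnion] at this
    obtain ⟨m, hm, hs'⟩ := this
    have hs2 := MvPolynomial.support_monomial_subset hs'
    rw [Finset.mem_singleton] at hs2
    subst hs2
    exact (supp_facts hf hg m hm).2.2.2
  · intro ρ h0
    rw [Ffree_eq lam hlam hf g (by omega) le_rfl ρ h0, mul_div_assoc]
    congr 1
    conv_lhs => rw [(f g).as_sum]
    rw [map_sum, map_sum, Finset.sum_div]
    apply Finset.sum_congr rfl
    intro m hm
    obtain ⟨m1, m2, m3, m4⟩ := supp_facts hf hg m hm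
    rw [ev, MvPolynomial.aeval_monomial, MvPolynomial.aeval_monomial, mul_div_assoc]
    congr 1
    rw [supp_expand m _ m3 _ (by intro i; simp), m1, m2, Finsupp.prod_fintype _ _ (by intro i; simp)]
    simp only [evf, pow_zero, one_mul, inv_pow]
    rw [div_eq_mul_inv, mul_comm]
    rfl

end Aux9

end PJnc

end PJsec

open NCQFT in
/-- (i) `(2λ)⁴ Â†_z F_g = 𝒢_g(z)` for all `g ≥ 1`; (ii) for `g ≥ 2`,
`F_g` is the unique (smooth, finitely-dependent) function of the `ϱ_l` with
`(2λ)⁴Â†_zF = 𝒢_g(z)` and `N̂F = (2g−2)F`; (iii) for `g ≥ 2`,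
`F_g = (2λ)^{4g−4} P_{3g−3}(ϱ)/ϱ₀^{2g−2}` with `P_{3g−3}` a `(3g−3)`-weighted polynomial
with rational coefficients in `ϱ₁/ϱ₀,…,ϱ_{3g−3}/ϱ₀`. -/
theorem stmt9 (lam : ℝ) (hlam : lam ≠ 0) :
    (∀ g, 1 ≤ g → ∀ ρ : ℕ → ℝ, ρ 0 ≠ 0 → ∀ z : ℂ, z ≠ 0 →
      (2 * (lam : ℂ)) ^ 4 * AdagScalar (Ffree lam g) ρ z = Gfun lam g ρ z) ∧
    (∀ g, 2 ≤ g → ∀ F : (ℕ → ℝ) → ℝ, (∃ M, SmoothScalarFam M F) →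
      (∀ ρ : ℕ → ℝ, ρ 0 ≠ 0 → ∀ z : ℂ, z ≠ 0 →
          (2 * (lam : ℂ)) ^ 4 * AdagScalar F ρ z = Gfun lam g ρ z) →
      (∀ ρ : ℕ → ℝ, ρ 0 ≠ 0 →
          (-∑' l : ℕ, ρ l * pdR F l ρ) = (2 * (g : ℝ) - 2) * F ρ) →
      ∀ ρ : ℕ → ℝ, ρ 0 ≠ 0 → F ρ = Ffree lam g ρ) ∧
    (∀ g, 2 ≤ g → ∃ P : MvPolynomial (Fin (3 * g - 3)) ℚ,
      IsWeighted (3 * g - 3) P ∧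
      ∀ ρ : ℕ → ℝ, ρ 0 ≠ 0 →
        Ffree lam g ρ = (2 * lam) ^ (4 * g - 4) *
          (MvPolynomial.aeval (fun i : Fin (3 * g - 3) => ρ ((i : ℕ) + 1) / ρ 0) P) /
            (ρ 0) ^ (2 * g - 2)) := by
  refine ⟨?_, ?_, ?_⟩
  · intro g hg ρ h0 z hz
    obtain ⟨f, hf⟩ := Aux9.exists_Good (g-1)
    rw [Nat.sub_add_cancel hg] at hf
    exact Aux9.part1 lam hlam hf hg ρ h0 z hz
  · rintro g hg F ⟨M, hM⟩ hA hN ρ h0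
    obtain ⟨f, hf⟩ := Aux9.exists_Good (g-1)
    rw [Nat.sub_add_cancel (by omega)] at hf
    exact Aux9.part2 lam hlam hf hg F M hM ρ h0 (hA ρ h0) (hN ρ h0)
  · intro g hg
    obtain ⟨f, hf⟩ := Aux9.exists_Good (g-1)
    rw [Nat.sub_add_cancel (by omega)] at hf
    exact Aux9.part3 lam hlam hf hg
end
end

section
/- The boundary annihilation operator is a left inverse of the boundary creation operator up to the counting operator: for every smooth function F of the variables ϱ₀ ≠ 0, ϱ₁, …, ϱ_M, one has Â_ǎ(z ↦ Â†_z F) = N̂F. -/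
open scoped BigOperators
open MeasureTheory

noncomputable section

theorem laurent_unique (e : ℤ →₀ ℂ)
    (he : ∀ z : ℂ, z ≠ 0 → (e.sum fun j a => a * z ^ j) = 0) : e = 0 := by
  let φ : ℤ → (ℂˣ →* ℂ) := fun j => (Units.coeHom ℂ).comp (zpowGroupHom j)
  have hφ : Function.Injective φ := by
    intro i j hij
    have h := DFunLike.congr_fun hij (Units.mk0 (2 : ℂ) two_ne_zero)
    simp only [φ, MonoidHom.comp_apply, zpowGroupHom_apply, Units.coeHom_apply,
      Units.val_zpow_eq_zpow_val, Units.val_mk0] at h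
    have h2 : ((2 : ℝ)) ^ i = (2 : ℝ) ^ j := by
      apply Complex.ofReal_injective
      push_cast
      exact h
    exact zpow_right_injective₀ (by norm_num) (by norm_num) h2
  have hli := (linearIndependent_monoidHom ℂˣ ℂ).comp φ hφ
  rw [linearIndependent_iff] at hli
  apply hli e
  funext u
  have := he u u.ne_zero
  rw [Finsupp.linearCombination_apply, Finsupp.sum, Finset.sum_apply]
  simpa [Finsupp.sum, φ] using this

open NCQFT in
theorem pdR_zero_of_lt (M : ℕ) (F : (ℕ → ℝ) → ℝ) (hF : SmoothScalarFam M F)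
    (ρ : ℕ → ℝ) (l : ℕ) (hl : M < l) : pdR F l ρ = 0 := by
  obtain ⟨Ft, -, hFt⟩ := hF
  have : (fun t => F (Function.update ρ l t)) = fun _ => F ρ := by
    funext t
    rw [hFt, hFt]
    congr 1
    funext i
    rw [Function.update_of_ne]
    have := i.2
    omega
  rw [pdR, this, deriv_const]

open NCQFT in
/-- `Â_ǎ ∘ Â† = N̂`: if the Laurent polynomial `z ↦ Â†_z F` has
coefficients `c`, then `−Σ_l (ϱ_l/(3+2l))·c_{−5−2l} = N̂F = −Σ_l ϱ_l ∂F/∂ϱ_l`. -/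
theorem stmt10 (M : ℕ) (F : (ℕ → ℝ) → ℝ) (hF : SmoothScalarFam M F)
    (ρ : ℕ → ℝ) (hρ0 : ρ 0 ≠ 0) (c : ℤ →₀ ℂ)
    (hc : ∀ z : ℂ, z ≠ 0 → AdagScalar F ρ z = ∑ j ∈ c.support, c j * z ^ (j : ℤ)) :
    (-∑' l : ℕ, ((ρ l : ℂ) / (3 + 2 * (l : ℂ))) * c (-(5 + 2 * (l : ℤ))))
      = (((-∑' l : ℕ, ρ l * pdR F l ρ : ℝ)) : ℂ) := by
  have hp := pdR_zero_of_lt M F hF ρ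
  set p : ℕ → ℝ := fun l => pdR F l ρ with hpdef
  have hp' : ∀ l, M < l → p l = 0 := hp
  let A : ℕ → ℂ := fun l => -((3 + 2 * (l : ℂ)) * (ρ (l + 1) : ℂ)) / (ρ 0 : ℂ) * (p l : ℂ)
  let B : ℕ → ℂ := fun l => (3 + 2 * (l : ℂ)) * (p l : ℂ)
  let d : ℤ →₀ ℂ := ∑ l ∈ Finset.range (M + 1),
    (Finsupp.single (-3 : ℤ) (A l) + Finsupp.single (-(5 + 2 * (l : ℤ))) (B l))
  let S : ℂ → (ℤ →₀ ℂ) →ₗ[ℂ] ℂ := fun z => Finsupp.linearCombination ℂ (fun j : ℤ => z ^ j)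
  have hS : ∀ z e, S z e = e.sum fun j a => a * z ^ j := by
    intro z e
    simp [S, Finsupp.linearCombination_apply]
  have hd : ∀ z : ℂ, z ≠ 0 → AdagScalar F ρ z = S z d := by
    intro z hz
    rw [AdagScalar, tsum_eq_sum (s := Finset.range (M + 1))]
    · simp only [d, map_sum, map_add]
      refine Finset.sum_congr rfl fun l _ => ?_
      simp only [S, Finsupp.linearCombination_single, smul_eq_mul, zpow_neg, A, B]
      have h1 : z ^ (5 + 2 * (l : ℤ)) = z ^ (5 + 2 * l) := by
        rw [← zpow_natCast]; push_cast; rfl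
      have h2 : z ^ (3 : ℤ) = z ^ 3 := by norm_cast
      rw [h1, h2, hpdef]
      have h3 : (ρ 0 : ℂ) ≠ 0 := by exact_mod_cast hρ0
      field_simp
    · intro l hl
      have : pdR F l ρ = 0 := hp l (by simpa using hl)
      simp [this]
  have hcd : c = d := by
    rw [← sub_eq_zero]
    apply laurent_unique
    intro z hz
    rw [← hS, map_sub, ← hd z hz, hc z hz, hS, Finsupp.sum, sub_self]
  have hcoef : ∀ l : ℕ, c (-(5 + 2 * (l : ℤ))) = B l := by
    intro l
    rw [hcd]
    simp only [d, Finsupp.finsetSum_apply, Finsupp.add_apply, Finsupp.single_apply]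
    rw [Finset.sum_eq_single l]
    · rw [if_neg (by omega), if_pos rfl, zero_add]
    · intro b _ hb
      rw [if_neg (by omega), if_neg (by omega), zero_add]
    · intro hl
      have : p l = 0 := hp' l (by simpa using hl)
      simp [A, B, this]
  rw [Complex.ofReal_neg, Complex.ofReal_tsum]
  congr 1
  refine tsum_congr fun l => ?_
  rw [hcoef]
  have h3 : (3 + 2 * (l : ℂ)) ≠ 0 := by
    have : ((3 + 2 * l : ℕ) : ℂ) ≠ 0 := by
      rw [Nat.cast_ne_zero]; omega
    exact_mod_cast this
  simp only [B, hpdef]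
  push_cast
  field_simp
end
end
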